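/- arXiv:2301.07011 — 3 statements merged into one kernel-verified Lean document; each statement's English description precedes it below -/
import Mathlib

section
/- Let Ω ⊆ ℝ^d be a bounded open set with smooth boundary, T > 0, ε > 0 and δ > 0. Let f = (f₁,…,f_d) with each f_j ∈ C²(ℝ) and f_j′ bounded, let B ∈ C¹(ℝ) be bounded with B ≥ 0, let A > 0, and let u₀ ∈ C_c^∞(Ω) with ‖u₀‖_{L^∞(Ω)} ≤ A. If u is a classical solution of the regularized viscosity problem with flux f, viscosity coefficient B + δ, parameter ε and data u₀, then ε Σ_{j=1}^d ∫_{Ω_T} |∂_{x_j} u(x,t)|² dx dt ≤ (1/(2δ)) ∫_Ω u₀(x)² dx ≤ (1/(2δ)) A² vol(Ω). -/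
open MeasureTheory Set

noncomputable section

/-- The spatial partial derivative of `v` in the `j`-th coordinate direction. -/
def pderiv' {d : ℕ} (v : (Fin d → ℝ) → ℝ) (j : Fin d) (x : Fin d → ℝ) : ℝ :=
  fderiv ℝ v x (Pi.single j 1)

/-- A classical solution of the regularized viscosity problem
`∂ₜ u + Σⱼ ∂ⱼ(fⱼ(u)) = ε Σⱼ ∂ⱼ((B(u)+δ) ∂ⱼ u)` on `Ω × (0,T)`, with homogeneous
Dirichlet boundary condition on `∂Ω × (0,T)` and initial data `u₀`. -/
structure IsClassicalSolution {d : ℕ} (Ω : Set (Fin d → ℝ)) (T ε δ : ℝ)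
    (f : Fin d → ℝ → ℝ) (B : ℝ → ℝ) (u₀ : (Fin d → ℝ) → ℝ)
    (u : (Fin d → ℝ) → ℝ → ℝ) : Prop where
  cont : ContinuousOn (fun p : (Fin d → ℝ) × ℝ => u p.1 p.2) (closure Ω ×ˢ Set.Icc 0 T)
  diff_t : ∀ x ∈ Ω, ∀ t ∈ Set.Ioo 0 T, DifferentiableAt ℝ (u x) t
  diff_x : ∀ x ∈ Ω, ∀ t ∈ Set.Ioo 0 T, DifferentiableAt ℝ (fun y => u y t) x
  diff_xx : ∀ j, ∀ x ∈ Ω, ∀ t ∈ Set.Ioo 0 T,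
      DifferentiableAt ℝ (fun y => pderiv' (fun z => u z t) j y) x
  cont_dt : ContinuousOn (fun p : (Fin d → ℝ) × ℝ => deriv (u p.1) p.2) (Ω ×ˢ Set.Ioo 0 T)
  cont_dx : ∀ j, ContinuousOn
      (fun p : (Fin d → ℝ) × ℝ => pderiv' (fun y => u y p.2) j p.1) (Ω ×ˢ Set.Ioo 0 T)
  cont_dxx : ∀ i j, ContinuousOn
      (fun p : (Fin d → ℝ) × ℝ => pderiv' (pderiv' (fun y => u y p.2) j) i p.1)
      (Ω ×ˢ Set.Ioo 0 T)
  pde : ∀ x ∈ Ω, ∀ t ∈ Set.Ioo 0 T,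
      deriv (u x) t + ∑ j, pderiv' (fun y => f j (u y t)) j x
        = ε * ∑ j, pderiv' (fun y => (B (u y t) + δ) * pderiv' (fun z => u z t) j y) j x
  bc : ∀ x ∈ frontier Ω, ∀ t ∈ Set.Ioo 0 T, u x t = 0
  ic : ∀ x ∈ Ω, u x 0 = u₀ x


open Filter Topology

section PartialDerivatives

variable {d : ℕ} {v w : (Fin d → ℝ) → ℝ} {x : Fin d → ℝ}

lemma HasDerivAt.differentiableAt_comp_pi {g : ℝ → ℝ} {g' : ℝ} (hg : HasDerivAt g g' (v x))
    (hv : DifferentiableAt ℝ v x) : DifferentiableAt ℝ (fun y => g (v y)) x :=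
  (hg.comp_hasFDerivAt x hv.hasFDerivAt).differentiableAt

lemma pderiv'_comp {g : ℝ → ℝ} {g' : ℝ} (hg : HasDerivAt g g' (v x))
    (hv : DifferentiableAt ℝ v x) (j : Fin d) :
    pderiv' (fun y => g (v y)) j x = g' * pderiv' v j x := by
  have h : HasFDerivAt (fun y => g (v y)) (g' • fderiv ℝ v x) x :=
    hg.comp_hasFDerivAt x hv.hasFDerivAt
  simp [pderiv', h.fderiv]

lemma pderiv'_mul (hv : DifferentiableAt ℝ v x) (hw : DifferentiableAt ℝ w x) (j : Fin d) :
    pderiv' (fun y => v y * w y) j x = v x * pderiv' w j x + w x * pderiv' v j x := by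
  have h := hv.hasFDerivAt.fun_mul hw.hasFDerivAt
  simp [pderiv', h.fderiv]

lemma pderiv'_sub (hv : DifferentiableAt ℝ v x) (hw : DifferentiableAt ℝ w x) (j : Fin d) :
    pderiv' (fun y => v y - w y) j x = pderiv' v j x - pderiv' w j x := by
  have h := hv.hasFDerivAt.fun_sub hw.hasFDerivAt
  simp [pderiv', h.fderiv]

lemma pderiv'_const_mul (c : ℝ) (hv : DifferentiableAt ℝ v x) (j : Fin d) :
    pderiv' (fun y => c * v y) j x = c * pderiv' v j x := by
  have h := hv.hasFDerivAt.const_mul c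
  simp [pderiv', h.fderiv]

/-- The integral over an open set of a partial derivative of a function vanishing off a compact
subset is zero. -/
lemma setIntegral_pderiv'_eq_zero {Ω K : Set (Fin d → ℝ)} (hΩ : IsOpen Ω) (hK : IsCompact K)
    (hKΩ : K ⊆ Ω) {H h : (Fin d → ℝ) → ℝ} {j : Fin d} (hH : ∀ x ∈ Ω \ K, H x = 0)
    (hdiff : ∀ x ∈ Ω, DifferentiableAt ℝ H x) (hh : ∀ x ∈ Ω, pderiv' H j x = h x)
    (hcont : ContinuousOn h Ω) :
    ∫ x in Ω, h x = 0 := by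
  have hopen : IsOpen (Ω \ K) := hΩ.sdiff hK.isClosed
  have hh0 : ∀ x ∈ Ω \ K, h x = 0 := by
    intro x hx
    have : H =ᶠ[𝓝 x] fun _ => 0 := by
      filter_upwards [hopen.mem_nhds hx] with y hy using hH y hy
    rw [← hh x hx.1, pderiv', this.fderiv_eq]
    simp
  have hHcont : ContinuousOn H Ω := fun x hx => (hdiff x hx).continuousAt.continuousWithinAt
  have hIH : Integrable (Ω.indicator H) := by
    rw [integrable_indicator_iff hΩ.measurableSet]
    exact ((hHcont.mono hKΩ).integrableOn_compact hK).of_forall_sdiff_eq_zero hΩ.measurableSet hH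
  have hIh : Integrable (Ω.indicator h) := by
    rw [integrable_indicator_iff hΩ.measurableSet]
    exact ((hcont.mono hKΩ).integrableOn_compact hK).of_forall_sdiff_eq_zero hΩ.measurableSet hh0
  have hline : ∀ x, HasLineDerivAt ℝ (Ω.indicator H) (Ω.indicator h x) x (Pi.single j 1) := by
    intro x
    by_cases hx : x ∈ Ω
    · have he : Ω.indicator H =ᶠ[𝓝 x] H := by
        filter_upwards [hΩ.mem_nhds hx] with y hy using indicator_of_mem hy H
      rw [indicator_of_mem hx, ← hh x hx]
      exact ((hdiff x hx).hasFDerivAt.congr_of_eventuallyEq he).hasLineDerivAt _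
    · have he : Ω.indicator H =ᶠ[𝓝 x] fun _ => 0 := by
        filter_upwards [hK.isClosed.isOpen_compl.mem_nhds fun h => hx (hKΩ h)] with y hy
        by_cases hyΩ : y ∈ Ω
        · rw [indicator_of_mem hyΩ, hH y ⟨hyΩ, hy⟩]
        · exact indicator_of_notMem hyΩ H
      rw [indicator_of_notMem hx]
      simpa using ((hasFDerivAt_const (0 : ℝ) x).congr_of_eventuallyEq he).hasLineDerivAt
        (Pi.single j (1 : ℝ))
  have := integral_bilinear_hasLineDerivAt_right_eq_neg_left_of_integrable (μ := volume)
    (f := fun _ : Fin d → ℝ => (1 : ℝ)) (f' := fun _ => 0) (g := Ω.indicator H)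
    (g' := Ω.indicator h) (v := Pi.single j 1) (B := ContinuousLinearMap.mul ℝ ℝ)
    (by simp) (by simpa using hIh) (by simpa using hIH)
    (fun x _ => by simpa using (hasFDerivAt_const (1 : ℝ) x).hasLineDerivAt (Pi.single j (1 : ℝ)))
    (fun x _ => hline x)
  simpa [integral_indicator hΩ.measurableSet] using this

end PartialDerivatives

/-- A function on the line has at most countably many zeros at which its derivative is nonzero. -/
lemma countable_setOf_eq_zero_of_hasDerivAt_ne_zero {φ φ' : ℝ → ℝ} {s : Set ℝ}
    (hs : ∀ r ∈ s, φ r = 0 ∧ HasDerivAt φ (φ' r) r ∧ φ' r ≠ 0) : s.Countable := by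
  refine (countable_setOfPred_isolated_right_within (s := s)).mono fun r hr => mem_sep hr ?_
  obtain ⟨-, hd, hne⟩ := hs r hr
  have h1 : ∀ᶠ z in 𝓝[s ∩ Ioi r] r, φ z ≠ 0 :=
    (hd.eventually_ne hne).filter_mono
      (nhdsWithin_mono r fun z hz => (mem_Ioi.1 hz.2).ne')
  have h2 : ∀ᶠ z in 𝓝[s ∩ Ioi r] r, z ∈ s :=
    eventually_nhdsWithin_of_forall fun z hz => hz.1
  rw [← empty_mem_iff_bot]
  filter_upwards [h1, h2] with z hz1 hz2
  exact hz1 (hs z hz2).1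

/-- A function whose derivative has the sign of the variable is minimal at the origin. -/
lemma nonneg_of_hasDerivAt_of_mul_nonneg {h h' : ℝ → ℝ} (hd : ∀ s, HasDerivAt h (h' s) s)
    (h0 : h 0 = 0) (hs : ∀ s, 0 ≤ s * h' s) (s : ℝ) : 0 ≤ h s := by
  have hc : Continuous h := continuous_iff_continuousAt.2 fun s => (hd s).continuousAt
  rcases le_total 0 s with h | h
  · rw [← h0]
    refine monotoneOn_of_deriv_nonneg (convex_Ici (0 : ℝ)) hc.continuousOn
      (fun x _ => (hd x).differentiableAt.differentiableWithinAt) (fun x hx => ?_)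
      self_mem_Ici h h
    rw [interior_Ici, mem_Ioi] at hx
    rw [(hd x).deriv]
    exact nonneg_of_mul_nonneg_right (hs x) hx
  · rw [← h0]
    refine antitoneOn_of_deriv_nonpos (convex_Iic (0 : ℝ)) hc.continuousOn
      (fun x _ => (hd x).differentiableAt.differentiableWithinAt) (fun x hx => ?_)
      h self_mem_Iic h
    rw [interior_Iic, mem_Iio] at hx
    rw [(hd x).deriv]
    have := hs x
    by_contra! hcon
    nlinarith [mul_neg_of_neg_of_pos hx hcon]

lemma mul_nonneg_of_hasDerivAt_nonneg {h h' : ℝ → ℝ} (hd : ∀ s, HasDerivAt h (h' s) s)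
    (h0 : h 0 = 0) (hs : ∀ s, 0 ≤ h' s) (s : ℝ) : 0 ≤ s * h s := by
  have hm : Monotone h := monotone_of_deriv_nonneg (fun x => (hd x).differentiableAt)
    fun x => by rw [(hd x).deriv]; exact hs x
  rcases le_total 0 s with h | h
  · exact mul_nonneg h (h0 ▸ hm h)
  · exact mul_nonneg_of_nonpos_of_nonpos h (h0 ▸ hm h)

lemma intervalIntegral_eq_zero_of_abs_le {g : ℝ → ℝ} {η s : ℝ} (hg : ∀ r, |r| ≤ η → g r = 0)
    (hs : |s| ≤ η) : ∫ r in (0 : ℝ)..s, g r = 0 := by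
  refine intervalIntegral.integral_zero_ae (.of_forall fun r hr => hg r ?_)
  have := abs_sub_left_of_mem_uIcc (uIoc_subset_uIcc hr)
  simp only [sub_zero] at this
  exact this.trans hs

/-- A truncation of the identity vanishing near the origin, together with its primitive. -/
lemma exists_truncation {ρ : ℝ → ℝ} {η : ℝ} (hρ : Continuous ρ) (hρ0 : ∀ r, 0 ≤ ρ r)
    (hρ1 : ∀ r, ρ r ≤ 1) (hρη : ∀ r, |r| ≤ η → ρ r = 0) :
    ∃ β G : ℝ → ℝ, (∀ s, HasDerivAt β (ρ s) s) ∧ (∀ s, HasDerivAt G (β s) s) ∧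
      (∀ s, |s| ≤ η → β s = 0) ∧ (∀ s, 0 ≤ G s) ∧ ∀ s, G s ≤ s ^ 2 / 2 := by
  set β : ℝ → ℝ := fun s => ∫ r in (0 : ℝ)..s, ρ r
  have hβ : ∀ s, HasDerivAt β (ρ s) s := fun s => hρ.integral_hasStrictDerivAt 0 s |>.hasDerivAt
  have hβc : Continuous β := continuous_iff_continuousAt.2 fun s => (hβ s).continuousAt
  have hG : ∀ s, HasDerivAt (fun s => ∫ r in (0 : ℝ)..s, β r) (β s) s :=
    fun s => hβc.integral_hasStrictDerivAt 0 s |>.hasDerivAt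
  have hβ0 : β 0 = 0 := by simp [β]
  refine ⟨β, fun s => ∫ r in (0 : ℝ)..s, β r, hβ, hG, fun s hs => ?_,
    nonneg_of_hasDerivAt_of_mul_nonneg hG (by simp)
      (mul_nonneg_of_hasDerivAt_nonneg hβ hβ0 hρ0), fun s => ?_⟩
  · exact intervalIntegral_eq_zero_of_abs_le hρη hs
  · have h1 : ∀ s, HasDerivAt (fun s => s - β s) (1 - ρ s) s :=
      fun s => (hasDerivAt_id s).sub (hβ s)
    have h2 : ∀ s, HasDerivAt (fun s => s ^ 2 / 2 - ∫ r in (0 : ℝ)..s, β r) (s - β s) s := by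
      intro s
      refine (((hasDerivAt_pow 2 s).div_const 2).sub (hG s)).congr_deriv ?_
      norm_num
    have := nonneg_of_hasDerivAt_of_mul_nonneg h2 (by simp)
      (mul_nonneg_of_hasDerivAt_nonneg h1 (by simp [hβ0]) fun s => sub_nonneg.2 (hρ1 s)) s
    linarith

namespace IsClassicalSolution

variable {d : ℕ} {Ω : Set (Fin d → ℝ)} {T ε δ : ℝ} {f : Fin d → ℝ → ℝ} {B : ℝ → ℝ}
  {u₀ : (Fin d → ℝ) → ℝ} {u : (Fin d → ℝ) → ℝ → ℝ}

lemma continuousOn_interior (hu : IsClassicalSolution Ω T ε δ f B u₀ u) :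
    ContinuousOn (fun p : (Fin d → ℝ) × ℝ => u p.1 p.2) (Ω ×ˢ Ioo 0 T) :=
  hu.cont.mono (prod_mono subset_closure Ioo_subset_Icc_self)

/-- Away from the initial and final times, the region where `|u| ≥ η` is contained in a compact
subset of `Ω × (0,T)`. -/
lemma exists_isCompact_superlevel (hu : IsClassicalSolution Ω T ε δ f B u₀ u) (hΩ : IsOpen Ω)
    (hΩbd : Bornology.IsBounded Ω) {a b η : ℝ} (ha : 0 < a) (hb : b < T) (hη : 0 < η) :
    ∃ K : Set ((Fin d → ℝ) × ℝ), IsCompact K ∧ K ⊆ Ω ×ˢ Ioo 0 T ∧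
      ∀ x ∈ Ω, ∀ t ∈ Icc a b, (x, t) ∉ K → |u x t| ≤ η := by
  have hcyl : IsCompact (closure Ω ×ˢ Icc a b) := hΩbd.isCompact_closure.prod isCompact_Icc
  have hcont : ContinuousOn (fun p : (Fin d → ℝ) × ℝ => |u p.1 p.2|) (closure Ω ×ˢ Icc a b) :=
    (hu.cont.mono (prod_mono_right (Icc_subset_Icc ha.le hb.le))).abs
  refine ⟨(closure Ω ×ˢ Icc a b) ∩ (fun p => |u p.1 p.2|) ⁻¹' Ici η,
    hcyl.of_isClosed_subset (hcont.preimage_isClosed_of_isClosed hcyl.isClosed isClosed_Ici)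
      inter_subset_left, ?_, fun x hx t ht h => ?_⟩
  · rintro ⟨x, t⟩ ⟨⟨hx, hta, htb⟩, hle⟩
    have ht : t ∈ Ioo 0 T := ⟨ha.trans_le hta, htb.trans_lt hb⟩
    refine ⟨?_, ht⟩
    by_contra hxΩ
    have h0 : u x t = 0 := hu.bc x (hΩ.frontier_eq ▸ ⟨hx, hxΩ⟩) t ht
    have : η ≤ |u x t| := hle
    rw [h0, abs_zero] at this
    linarith
  · by_contra! hcon
    exact h ⟨⟨subset_closure hx, ht⟩, hcon.le⟩

/-- The energy inequality tested with a truncation of `u` having derivative `ρ`. -/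
lemma truncated_energy_inequality (hu : IsClassicalSolution Ω T ε δ f B u₀ u) (hΩ : IsOpen Ω)
    (hΩbd : Bornology.IsBounded Ω) (hε : 0 < ε) (hf : ∀ j, ContDiff ℝ 2 (f j))
    (hB : ContDiff ℝ 1 B) (hB0 : ∀ y, 0 ≤ B y) {a b η : ℝ} (ha : 0 < a) (hab : a ≤ b)
    (hb : b < T) (hη : 0 < η) {ρ : ℝ → ℝ} (hρ : Continuous ρ) (hρ0 : ∀ r, 0 ≤ ρ r)
    (hρ1 : ∀ r, ρ r ≤ 1) (hρη : ∀ r, |r| ≤ η → ρ r = 0) :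
    IntegrableOn (fun p : (Fin d → ℝ) × ℝ =>
      ρ (u p.1 p.2) * ∑ j, (pderiv' (fun y => u y p.2) j p.1) ^ 2) (Ω ×ˢ Ioc a b) ∧
    ε * δ * ∫ p in Ω ×ˢ Ioc a b, ρ (u p.1 p.2) * ∑ j, (pderiv' (fun y => u y p.2) j p.1) ^ 2
      ≤ ∫ x in Ω, (u x a) ^ 2 / 2 := by
  obtain ⟨β, G, hβ, hG, hβη, hG0, hGle⟩ := exists_truncation hρ hρ0 hρ1 hρη
  obtain ⟨K, hK, hKsub, hKη⟩ := hu.exists_isCompact_superlevel hΩ hΩbd ha hb hη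
  have hβc : Continuous β := continuous_iff_continuousAt.2 fun s => (hβ s).continuousAt
  have hGc : Continuous G := continuous_iff_continuousAt.2 fun s => (hG s).continuousAt
  have hfc (j) : Continuous (deriv (f j)) := (hf j).continuous_deriv (by norm_num)
  have hBc : Continuous B := hB.continuous
  have hB'c : Continuous (deriv B) := hB.continuous_deriv le_rfl
  have hBd (s) : HasDerivAt B (deriv B s) s := (hB.differentiable (by norm_num) s).hasDerivAt
  have hfd (j s) : HasDerivAt (f j) (deriv (f j) s) s :=
    ((hf j).differentiable (by norm_num) s).hasDerivAt
  have hIoc : Ioc a b ⊆ Ioo 0 T := fun t ht => ⟨ha.trans ht.1, ht.2.trans_lt hb⟩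
  have hIcc : Icc a b ⊆ Ioo 0 T := fun t ht => ⟨ha.trans_le ht.1, ht.2.trans_lt hb⟩
  have huc := hu.continuousOn_interior
  have hcomp {g : ℝ → ℝ} (hg : Continuous g) :
      ContinuousOn (fun p : (Fin d → ℝ) × ℝ => g (u p.1 p.2)) (Ω ×ˢ Ioo 0 T) :=
    hg.comp_continuousOn huc
  have hint {g : (Fin d → ℝ) × ℝ → ℝ} (hg : ContinuousOn g (Ω ×ˢ Ioo 0 T))
      (hg0 : ∀ x t, |u x t| ≤ η → g (x, t) = 0) : IntegrableOn g (Ω ×ˢ Ioc a b) :=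
    ((hg.mono hKsub).integrableOn_compact hK).of_forall_sdiff_eq_zero
      (hΩ.measurableSet.prod measurableSet_Ioc)
      fun p hp => hg0 _ _ (hKη _ hp.1.1 _ (Ioc_subset_Icc_self hp.1.2) hp.2)
  set D : Fin d → (Fin d → ℝ) × ℝ → ℝ := fun j p => pderiv' (fun y => u y p.2) j p.1
  set D2 : Fin d → (Fin d → ℝ) × ℝ → ℝ :=
    fun j p => pderiv' (pderiv' (fun y => u y p.2) j) j p.1
  have hDc (j) : ContinuousOn (D j) (Ω ×ˢ Ioo 0 T) := hu.cont_dx j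
  have hD2c (j) : ContinuousOn (D2 j) (Ω ×ˢ Ioo 0 T) := hu.cont_dxx j j
  set P : (Fin d → ℝ) × ℝ → ℝ := fun p => β (u p.1 p.2) * deriv (u p.1) p.2
  set L : Fin d → (Fin d → ℝ) × ℝ → ℝ := fun j p =>
    (B (u p.1 p.2) + δ) * D2 j p + D j p * (deriv B (u p.1 p.2) * D j p)
  set q : Fin d → (Fin d → ℝ) × ℝ → ℝ := fun j p =>
    deriv (f j) (u p.1 p.2) * β (u p.1 p.2) * D j p - ε * (β (u p.1 p.2) * L j p
      + (B (u p.1 p.2) + δ) * D j p * (ρ (u p.1 p.2) * D j p))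
  set R : (Fin d → ℝ) × ℝ → ℝ := fun p =>
    ε * ∑ j, ρ (u p.1 p.2) * ((B (u p.1 p.2) + δ) * D j p ^ 2)
  have hBδ : ContinuousOn (fun p : (Fin d → ℝ) × ℝ => B (u p.1 p.2) + δ) (Ω ×ˢ Ioo 0 T) :=
    (hcomp hBc).add continuousOn_const
  have hLc (j) : ContinuousOn (L j) (Ω ×ˢ Ioo 0 T) :=
    (hBδ.mul (hD2c j)).add ((hDc j).mul ((hcomp hB'c).mul (hDc j)))
  have hPc : ContinuousOn P (Ω ×ˢ Ioo 0 T) := (hcomp hβc).mul hu.cont_dt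
  have hqc (j) : ContinuousOn (q j) (Ω ×ˢ Ioo 0 T) :=
    (((hcomp (hfc j)).mul (hcomp hβc)).mul (hDc j)).sub (continuousOn_const.mul
      (((hcomp hβc).mul (hLc j)).add ((hBδ.mul (hDc j)).mul ((hcomp hρ).mul (hDc j)))))
  have hRc : ContinuousOn R (Ω ×ˢ Ioo 0 T) := continuousOn_const.mul
    (continuousOn_finsetSum _ fun j _ => (hcomp hρ).mul (hBδ.mul ((hDc j).pow 2)))
  have hSc : ContinuousOn (fun p : (Fin d → ℝ) × ℝ => ρ (u p.1 p.2) * ∑ j, D j p ^ 2)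
      (Ω ×ˢ Ioo 0 T) := (hcomp hρ).mul (continuousOn_finsetSum _ fun j _ => (hDc j).pow 2)
  have hPi : IntegrableOn P (Ω ×ˢ Ioc a b) := hint hPc fun x t h => by simp [P, hβη _ h]
  have hqi (j) : IntegrableOn (q j) (Ω ×ˢ Ioc a b) :=
    hint (hqc j) fun x t h => by simp [q, hβη _ h, hρη _ h]
  have hRi : IntegrableOn R (Ω ×ˢ Ioc a b) := hint hRc fun x t h => by simp [R, hρη _ h]
  have hSi : IntegrableOn (fun p : (Fin d → ℝ) × ℝ => ρ (u p.1 p.2) * ∑ j, D j p ^ 2)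
      (Ω ×ˢ Ioc a b) := hint hSc fun x t h => by simp [hρη _ h]
  refine ⟨hSi, ?_⟩
  -- the equation multiplied by the truncation
  have hflux (j x) (hx : x ∈ Ω) (t) (ht : t ∈ Ioo 0 T) :
      pderiv' (fun y => (B (u y t) + δ) * pderiv' (fun z => u z t) j y) j x = L j (x, t) := by
    have hv := hu.diff_x x hx t ht
    have hg : HasDerivAt (fun s => B s + δ) (deriv B (u x t)) (u x t) := (hBd _).add_const δ
    have hd : DifferentiableAt ℝ (fun y => B (u y t) + δ) x :=
      hg.differentiableAt_comp_pi hv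
    rw [pderiv'_mul hd (hu.diff_xx j x hx t ht), pderiv'_comp hg hv]
  have hid (p) (hp : p ∈ Ω ×ˢ Ioc a b) : R p = -P p - ∑ j, q j p := by
    obtain ⟨x, t⟩ := p
    have ht := hIoc hp.2
    have hpde := hu.pde x hp.1 t ht
    have e1 (j) : pderiv' (fun y => f j (u y t)) j x = deriv (f j) (u x t) * D j (x, t) :=
      pderiv'_comp (hfd j _) (hu.diff_x x hp.1 t ht) j
    simp only [e1, hflux _ x hp.1 t ht] at hpde
    have e2 : ∑ j, q j (x, t) = β (u x t) * ∑ j, deriv (f j) (u x t) * D j (x, t)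
        - ε * (β (u x t) * ∑ j, L j (x, t)) - R (x, t) := by
      simp only [q, R, Finset.mul_sum, ← Finset.sum_sub_distrib]
      exact Finset.sum_congr rfl fun j _ => by ring
    rw [e2]
    simp only [P]
    linear_combination β (u x t) * hpde
  have hq0 (j) : ∫ p in Ω ×ˢ Ioc a b, q j p = 0 := by
    have hi := hqi j
    rw [IntegrableOn, Measure.volume_eq_prod, ← Measure.prod_restrict] at hi
    rw [Measure.volume_eq_prod, ← Measure.prod_restrict, integral_prod_symm _ hi]
    refine setIntegral_eq_zero_of_forall_eq_zero fun t ht => ?_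
    have ht' := hIoc ht
    have hfβ : Continuous fun s => deriv (f j) s * β s := (hfc j).mul hβc
    have hF (s) : HasDerivAt (fun s => ∫ r in (0 : ℝ)..s, deriv (f j) r * β r)
        (deriv (f j) s * β s) s := (hfβ.integral_hasStrictDerivAt 0 s).hasDerivAt
    have hdF (x) (hx : x ∈ Ω) :
        DifferentiableAt ℝ (fun y => ∫ r in (0 : ℝ)..u y t, deriv (f j) r * β r) x :=
      (hF (u x t)).differentiableAt_comp_pi (hu.diff_x x hx t ht')
    have hdβ (x) (hx : x ∈ Ω) : DifferentiableAt ℝ (fun y => β (u y t)) x :=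
      (hβ (u x t)).differentiableAt_comp_pi (hu.diff_x x hx t ht')
    have hdB (x) (hx : x ∈ Ω) :
        DifferentiableAt ℝ (fun y => (B (u y t) + δ) * pderiv' (fun z => u z t) j y) x :=
      (((hBd (u x t)).differentiableAt_comp_pi (hu.diff_x x hx t ht')).add_const δ).fun_mul
        (hu.diff_xx j x hx t ht')
    refine setIntegral_pderiv'_eq_zero (K := Prod.fst '' K) (j := j)
      (H := fun y => (∫ r in (0 : ℝ)..u y t, deriv (f j) r * β r)
        - ε * (β (u y t) * ((B (u y t) + δ) * pderiv' (fun z => u z t) j y)))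
      hΩ (hK.image continuous_fst) ?_ ?_ ?_ ?_ ?_
    · rintro _ ⟨p, hp, rfl⟩
      exact (hKsub hp).1
    · rintro x ⟨hx, hxK⟩
      have hle := hKη x hx t (Ioc_subset_Icc_self ht) fun h => hxK ⟨_, h, rfl⟩
      have h1 : ∫ r in (0 : ℝ)..u x t, deriv (f j) r * β r = 0 :=
        intervalIntegral_eq_zero_of_abs_le (fun r hr => by rw [hβη r hr, mul_zero]) hle
      simp [h1, hβη _ hle]
    · exact fun x hx => (hdF x hx).sub (((hdβ x hx).fun_mul (hdB x hx)).const_mul ε)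
    · intro x hx
      rw [pderiv'_sub (hdF x hx) (((hdβ x hx).fun_mul (hdB x hx)).const_mul ε),
        pderiv'_const_mul ε ((hdβ x hx).fun_mul (hdB x hx)), pderiv'_mul (hdβ x hx) (hdB x hx),
        hflux j x hx t ht', pderiv'_comp (hF _) (hu.diff_x x hx t ht'),
        pderiv'_comp (hβ _) (hu.diff_x x hx t ht')]
    · exact (hqc j).comp (by fun_prop) fun x hx => ⟨hx, ht'⟩
  have hslice (t) (ht : t ∈ Icc 0 T) : ContinuousOn (fun x => u x t) (closure Ω) :=
    hu.cont.comp (f := fun x => (x, t)) (by fun_prop) fun x hx => ⟨hx, ht⟩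
  have hslice_int {g : ℝ → ℝ} (hg : Continuous g) (t) (ht : t ∈ Icc a b) :
      IntegrableOn (fun x => g (u x t)) Ω :=
    ((hg.comp_continuousOn (hslice t (Ioo_subset_Icc_self (hIcc ht)))).integrableOn_compact
      hΩbd.isCompact_closure).mono_set subset_closure
  have hP : ∫ p in Ω ×ˢ Ioc a b, P p = (∫ x in Ω, G (u x b)) - ∫ x in Ω, G (u x a) := by
    rw [Measure.volume_eq_prod, setIntegral_prod _ (by rwa [← Measure.volume_eq_prod]),
      ← integral_sub (hslice_int hGc b (right_mem_Icc.2 hab))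
        (hslice_int hGc a (left_mem_Icc.2 hab))]
    refine setIntegral_congr_fun hΩ.measurableSet fun x hx => ?_
    rw [← intervalIntegral.integral_of_le hab]
    refine intervalIntegral.integral_eq_sub_of_hasDerivAt (f := fun t => G (u x t))
      (fun t ht => ?_) (ContinuousOn.intervalIntegrable ?_)
    · rw [uIcc_of_le hab] at ht
      exact (hG _).comp t (hu.diff_t x hx t (hIcc ht)).hasDerivAt
    · rw [uIcc_of_le hab]
      exact hPc.comp (by fun_prop) fun t ht => ⟨hx, hIcc ht⟩
  have hE : MeasurableSet (Ω ×ˢ Ioc a b) := hΩ.measurableSet.prod measurableSet_Ioc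
  have hR : ∫ p in Ω ×ˢ Ioc a b, R p = (∫ x in Ω, G (u x a)) - ∫ x in Ω, G (u x b) := by
    rw [setIntegral_congr_fun hE hid,
      integral_sub hPi.fun_neg (integrable_finsetSum _ fun j _ => hqi j),
      integral_finsetSum _ fun j _ => hqi j, integral_neg, hP]
    simp [hq0]
  have hGb : 0 ≤ ∫ x in Ω, G (u x b) := integral_nonneg fun x => hG0 _
  calc ε * δ * ∫ p in Ω ×ˢ Ioc a b, ρ (u p.1 p.2) * ∑ j, D j p ^ 2
      = ∫ p in Ω ×ˢ Ioc a b, ε * δ * (ρ (u p.1 p.2) * ∑ j, D j p ^ 2) :=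
        (integral_const_mul _ _).symm
    _ ≤ ∫ p in Ω ×ˢ Ioc a b, R p := by
        refine integral_mono (hSi.const_mul _) hRi fun p => ?_
        simp only [R, Finset.mul_sum]
        refine Finset.sum_le_sum fun j _ => ?_
        have : 0 ≤ ε * (ρ (u p.1 p.2) * (B (u p.1 p.2) * D j p ^ 2)) :=
          mul_nonneg hε.le (mul_nonneg (hρ0 _) (mul_nonneg (hB0 _) (sq_nonneg _)))
        linarith
    _ ≤ ∫ x in Ω, G (u x a) := by linarith
    _ ≤ ∫ x in Ω, (u x a) ^ 2 / 2 :=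
        integral_mono (hslice_int hGc a (left_mem_Icc.2 hab))
          (hslice_int (g := fun s => s ^ 2 / 2) (by fun_prop) a (left_mem_Icc.2 hab))
          fun x => hGle _

lemma ae_pderiv'_eq_zero (hu : IsClassicalSolution Ω T ε δ f B u₀ u) (hΩ : IsOpen Ω) (j : Fin d) :
    ∀ᵐ p ∂(volume : Measure ((Fin d → ℝ) × ℝ)).restrict (Ω ×ˢ Ioo 0 T),
      u p.1 p.2 = 0 → pderiv' (fun y => u y p.2) j p.1 = 0 := by
  classical
  have hS : MeasurableSet (Ω ×ˢ Ioo 0 T) := hΩ.measurableSet.prod measurableSet_Ioo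
  have hU := hu.continuousOn_interior.measurable_piecewise
    (continuousOn_const (c := (0 : ℝ))) hS
  have hV := (hu.cont_dx j).measurable_piecewise (continuousOn_const (c := (0 : ℝ))) hS
  rw [ae_restrict_iff' hS]
  have hmeas : MeasurableSet ((Ω ×ˢ Ioo 0 T) ∩ ((fun p : (Fin d → ℝ) × ℝ => u p.1 p.2) ⁻¹' {0}
      ∩ (fun p : (Fin d → ℝ) × ℝ => pderiv' (fun y => u y p.2) j p.1) ⁻¹' {0}ᶜ)) := by
    convert hS.inter ((hU (measurableSet_singleton 0)).inter
      (hV (measurableSet_singleton 0).compl)) using 1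
    ext p
    simp only [mem_inter_iff, mem_preimage]
    refine and_congr_right fun hp => ?_
    rw [piecewise_eq_of_mem _ _ _ hp, piecewise_eq_of_mem _ _ _ hp]
  have : (volume : Measure ((Fin d → ℝ) × ℝ)).IsAddHaarMeasure :=
    inferInstanceAs ((volume : Measure (Fin d → ℝ)).prod (volume : Measure ℝ)).IsAddHaarMeasure
  have := ae_mem_of_ae_add_linearMap_mem
    (LinearMap.toSpanSingleton ℝ ((Fin d → ℝ) × ℝ) (Pi.single j 1, 0)) volume volume
    hmeas.compl fun y => ?_
  · filter_upwards [this] with p hp hpS h0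
    by_contra hne
    exact hp ⟨hpS, h0, hne⟩
  · refine (Set.Countable.ae_notMem (s := (fun r : ℝ =>
      y + LinearMap.toSpanSingleton ℝ ((Fin d → ℝ) × ℝ) (Pi.single j 1, 0) r) ⁻¹' _) ?_ volume)
    refine countable_setOf_eq_zero_of_hasDerivAt_ne_zero
      (φ := fun r => u (y.1 + r • Pi.single j 1) y.2)
      (φ' := fun r => pderiv' (fun z => u z y.2) j (y.1 + r • Pi.single j 1)) fun r hr => ?_
    have hL : y + LinearMap.toSpanSingleton ℝ ((Fin d → ℝ) × ℝ) (Pi.single j 1, 0) r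
        = (y.1 + r • Pi.single j 1, y.2) := Prod.ext (by simp) (by simp)
    rw [mem_preimage, hL] at hr
    obtain ⟨⟨hx, ht⟩, h0, hne⟩ := hr
    refine ⟨h0, ?_, hne⟩
    have hl : HasDerivAt (fun r : ℝ => y.1 + r • (Pi.single j 1 : Fin d → ℝ)) (Pi.single j 1) r := by
      simpa using ((hasDerivAt_id r).smul_const (Pi.single j 1 : Fin d → ℝ)).const_add y.1
    exact (hu.diff_x _ hx _ ht).hasFDerivAt.comp_hasDerivAt r hl

lemma tendsto_integral_sq (hu : IsClassicalSolution Ω T ε δ f B u₀ u) (hΩ : IsOpen Ω)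
    (hΩbd : Bornology.IsBounded Ω) {a : ℕ → ℝ} (ha : ∀ n, a n ∈ Ioo 0 T)
    (ha0 : Tendsto a atTop (𝓝 0)) :
    Tendsto (fun n => ∫ x in Ω, (u x (a n)) ^ 2 / 2) atTop (𝓝 (∫ x in Ω, (u₀ x) ^ 2 / 2)) := by
  have hT : 0 < T := (ha 0).1.trans (ha 0).2
  obtain ⟨C, hC⟩ :=
    (hΩbd.isCompact_closure.prod isCompact_Icc).exists_bound_of_continuousOn hu.cont
  have : IsFiniteMeasure (volume.restrict Ω) := ⟨by simpa using hΩbd.measure_lt_top⟩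
  refine tendsto_integral_of_dominated_convergence (fun _ => C ^ 2 / 2) (fun n => ?_)
    (integrable_const _) (fun n => ?_) ?_
  · have : ContinuousOn (fun x => u x (a n)) Ω :=
      hu.cont.comp (f := fun x => (x, a n)) (by fun_prop)
        fun x hx => ⟨subset_closure hx, Ioo_subset_Icc_self (ha n)⟩
    exact ((this.pow 2).div_const 2).aestronglyMeasurable hΩ.measurableSet
  · filter_upwards [ae_restrict_mem hΩ.measurableSet] with x hx
    have h := hC (x, a n) ⟨subset_closure hx, Ioo_subset_Icc_self (ha n)⟩
    simp only [Real.norm_eq_abs] at h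
    rw [Real.norm_of_nonneg (by positivity)]
    have : u x (a n) ^ 2 ≤ C ^ 2 := sq_le_sq' (by linarith [neg_abs_le (u x (a n))])
      ((le_abs_self _).trans h)
    linarith
  · filter_upwards [ae_restrict_mem hΩ.measurableSet] with x hx
    have hc : ContinuousOn (u x) (Icc 0 T) :=
      hu.cont.comp (f := fun t => (x, t)) (by fun_prop) fun t ht => ⟨subset_closure hx, ht⟩
    have hlim : Tendsto (fun n => u x (a n)) atTop (𝓝 (u₀ x)) := by
      rw [← hu.ic x hx]
      exact (hc 0 ⟨le_rfl, hT.le⟩).tendsto.comp (tendsto_nhdsWithin_iff.2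
        ⟨ha0, .of_forall fun n => Ioo_subset_Icc_self (ha n)⟩)
    exact (hlim.pow 2).div_const 2

lemma lintegral_sum_sq_pderiv'_le (hu : IsClassicalSolution Ω T ε δ f B u₀ u) (hΩ : IsOpen Ω)
    (hΩbd : Bornology.IsBounded Ω) (hT : 0 < T) (hε : 0 < ε) (hδ : 0 < δ)
    (hf : ∀ j, ContDiff ℝ 2 (f j)) (hB : ContDiff ℝ 1 B) (hB0 : ∀ y, 0 ≤ B y) :
    ∫⁻ p in Ω ×ˢ Ioo 0 T, ENNReal.ofReal (∑ j, (pderiv' (fun y => u y p.2) j p.1) ^ 2)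
      ≤ ENNReal.ofReal ((∫ x in Ω, (u₀ x) ^ 2 / 2) / (ε * δ)) := by
  set c : ℕ → ℝ := fun n => T / (n + 3)
  have hc (n) : 0 < c n := by positivity
  have hc2 (n) : 2 * c n < T := by
    have hn : (0 : ℝ) < n + 3 := by positivity
    simp only [c]
    rw [← mul_div_assoc, div_lt_iff₀ hn]
    nlinarith [(Nat.cast_nonneg n : (0 : ℝ) ≤ n)]
  have hc0 : Tendsto c atTop (𝓝 0) := by
    simpa [Function.comp_def, c] using
      (tendsto_const_div_atTop_nhds_zero_nat T).comp (tendsto_add_atTop_nat 3)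
  set ρ : ℕ → ℝ → ℝ := fun n r => max 0 (min 1 (|r| * (n + 1) - 1))
  have hρ (n) : Continuous (ρ n) := by fun_prop
  have hρ0 (n r) : 0 ≤ ρ n r := le_max_left _ _
  have hρ1 (n r) : ρ n r ≤ 1 := max_le zero_le_one (min_le_left _ _)
  have hρη (n : ℕ) (r) (hr : |r| ≤ 1 / ((n : ℝ) + 1)) : ρ n r = 0 := by
    rw [le_div_iff₀ (by positivity)] at hr
    exact max_eq_left ((min_le_right _ _).trans (by linarith))
  have hρlim (r) (hr : r ≠ 0) : ∀ᶠ n in atTop, ρ n r = 1 := by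
    filter_upwards [(tendsto_natCast_atTop_atTop (R := ℝ)).eventually_ge_atTop (2 / |r|)] with n hn
    rw [div_le_iff₀ (abs_pos.2 hr)] at hn
    have : 1 ≤ |r| * (n + 1) - 1 := by nlinarith [abs_nonneg r]
    simp [ρ, min_eq_left this]
  have hE (n) : MeasurableSet (Ω ×ˢ Ioc (c n) (T - c n)) :=
    hΩ.measurableSet.prod measurableSet_Ioc
  have htrunc (n) := hu.truncated_energy_inequality hΩ hΩbd hε hf hB hB0 (hc n)
    (b := T - c n) (by linarith [hc2 n]) (by linarith [hc n]) (Nat.one_div_pos_of_nat (n := n))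
    (hρ n) (hρ0 n) (hρ1 n) (hρη n)
  set S : (Fin d → ℝ) × ℝ → ℝ := fun p => ∑ j, (pderiv' (fun y => u y p.2) j p.1) ^ 2
  set g : ℕ → (Fin d → ℝ) × ℝ → ℝ := fun n =>
    (Ω ×ˢ Ioc (c n) (T - c n)).indicator fun p => ρ n (u p.1 p.2) * S p
  have hgi (n) : Integrable (g n) := (integrable_indicator_iff (hE n)).2 (htrunc n).1
  have hg0 (n) : 0 ≤ g n := indicator_nonneg fun p _ =>
    mul_nonneg (hρ0 _ _) (Finset.sum_nonneg fun j _ => sq_nonneg _)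
  have hlim : ∀ᵐ p ∂(volume : Measure ((Fin d → ℝ) × ℝ)).restrict (Ω ×ˢ Ioo 0 T),
      Tendsto (fun n => ENNReal.ofReal (g n p)) atTop (𝓝 (ENNReal.ofReal (S p))) := by
    filter_upwards [ae_all_iff.2 fun j => hu.ae_pderiv'_eq_zero hΩ j,
      ae_restrict_mem (hΩ.measurableSet.prod measurableSet_Ioo)] with p hp hpS
    refine tendsto_nhds_of_eventually_eq ?_
    have h1 : ∀ᶠ n in atTop, c n < p.2 := hc0.eventually_lt_const hpS.2.1
    have h2 : ∀ᶠ n in atTop, c n < T - p.2 := hc0.eventually_lt_const (sub_pos.2 hpS.2.2)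
    have h3 : ∀ᶠ n in atTop, ρ n (u p.1 p.2) * S p = S p := by
      by_cases h0 : u p.1 p.2 = 0
      · have : S p = 0 := Finset.sum_eq_zero fun j _ => by rw [hp j h0]; simp
        simp [this]
      · filter_upwards [hρlim _ h0] with n hn
        rw [hn, one_mul]
    filter_upwards [h1, h2, h3] with n hn1 hn2 hn3
    have hmem : p ∈ Ω ×ˢ Ioc (c n) (T - c n) := ⟨hpS.1, hn1, by linarith⟩
    simp only [g]
    rw [indicator_of_mem hmem, hn3]
  have hbound (n) : ∫⁻ p in Ω ×ˢ Ioo 0 T, ENNReal.ofReal (g n p)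
      ≤ ENNReal.ofReal ((∫ x in Ω, (u x (c n)) ^ 2 / 2) / (ε * δ)) := by
    refine (setLIntegral_le_lintegral _ _).trans ?_
    rw [← ofReal_integral_eq_lintegral_ofReal (hgi n) (.of_forall (hg0 n)),
      integral_indicator (hE n)]
    refine ENNReal.ofReal_le_ofReal ?_
    rw [le_div_iff₀ (mul_pos hε hδ), mul_comm]
    exact (htrunc n).2
  have hblim : Tendsto (fun n => ENNReal.ofReal ((∫ x in Ω, (u x (c n)) ^ 2 / 2) / (ε * δ))) atTop
      (𝓝 (ENNReal.ofReal ((∫ x in Ω, (u₀ x) ^ 2 / 2) / (ε * δ)))) :=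
    ENNReal.tendsto_ofReal ((hu.tendsto_integral_sq hΩ hΩbd
      (fun n => ⟨hc n, by linarith [hc n, hc2 n]⟩) hc0).div_const _)
  calc ∫⁻ p in Ω ×ˢ Ioo 0 T, ENNReal.ofReal (S p)
      = ∫⁻ p in Ω ×ˢ Ioo 0 T, liminf (fun n => ENNReal.ofReal (g n p)) atTop :=
        lintegral_congr_ae (hlim.mono fun p hp => hp.liminf_eq.symm)
    _ ≤ liminf (fun n => ∫⁻ p in Ω ×ˢ Ioo 0 T, ENNReal.ofReal (g n p)) atTop :=
        lintegral_liminf_le' fun n => (hgi n).aemeasurable.ennreal_ofReal.restrict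
    _ ≤ liminf (fun n => ENNReal.ofReal ((∫ x in Ω, (u x (c n)) ^ 2 / 2) / (ε * δ))) atTop :=
        liminf_le_liminf (.of_forall hbound)
    _ = _ := hblim.liminf_eq

end IsClassicalSolution

/-- **Energy estimate**: for a classical solution of the regularized viscosity problem with
viscosity `B + δ`,
`ε Σⱼ ∫_{Ω_T} |∂ⱼu|² ≤ (1/(2δ)) ∫_Ω u₀² ≤ (1/(2δ)) A² vol(Ω)`. -/
theorem energy_estimate_gradient
    (d : ℕ) (Ω : Set (Fin d → ℝ)) (hΩopen : IsOpen Ω) (hΩbd : Bornology.IsBounded Ω)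
    (T ε δ : ℝ) (hT : 0 < T) (hε : 0 < ε) (hδ : 0 < δ)
    (f : Fin d → ℝ → ℝ) (hf : ∀ j, ContDiff ℝ 2 (f j))
    (hf' : ∀ j, ∃ C, ∀ y : ℝ, |deriv (f j) y| ≤ C)
    (B : ℝ → ℝ) (hB : ContDiff ℝ 1 B) (hBbd : ∃ C, ∀ y : ℝ, |B y| ≤ C)
    (hBnonneg : ∀ y : ℝ, 0 ≤ B y)
    (A : ℝ) (hA : 0 < A)
    (u₀ : (Fin d → ℝ) → ℝ) (hu₀smooth : ContDiff ℝ (⊤ : ℕ∞) u₀)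
    (hu₀supp : HasCompactSupport u₀) (hu₀Ω : tsupport u₀ ⊆ Ω)
    (hu₀A : ∀ x, |u₀ x| ≤ A)
    (u : (Fin d → ℝ) → ℝ → ℝ) (hu : IsClassicalSolution Ω T ε δ f B u₀ u) :
    ε * ∑ j, ∫ p in Ω ×ˢ Set.Ioo 0 T, (pderiv' (fun y => u y p.2) j p.1) ^ 2
        ≤ (1 / (2 * δ)) * ∫ x in Ω, (u₀ x) ^ 2 ∧
    (1 / (2 * δ)) * ∫ x in Ω, (u₀ x) ^ 2 ≤ (1 / (2 * δ)) * A ^ 2 * (volume Ω).toReal := by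
  constructor
  · have hS : MeasurableSet (Ω ×ˢ Ioo 0 T) := hΩopen.measurableSet.prod measurableSet_Ioo
    have hle := hu.lintegral_sum_sq_pderiv'_le hΩopen hΩbd hT hε hδ hf hB hBnonneg
    have hmeas (j) : AEStronglyMeasurable (fun p : (Fin d → ℝ) × ℝ =>
        (pderiv' (fun y => u y p.2) j p.1) ^ 2) (volume.restrict (Ω ×ˢ Ioo 0 T)) :=
      ((hu.cont_dx j).pow 2).aestronglyMeasurable hS
    have hsum0 (p : (Fin d → ℝ) × ℝ) : 0 ≤ ∑ j, (pderiv' (fun y => u y p.2) j p.1) ^ 2 :=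
      Finset.sum_nonneg fun j _ => sq_nonneg _
    have hsum : IntegrableOn (fun p : (Fin d → ℝ) × ℝ =>
        ∑ j, (pderiv' (fun y => u y p.2) j p.1) ^ 2) (Ω ×ˢ Ioo 0 T) :=
      ⟨Finset.aestronglyMeasurable_fun_sum _ fun j _ => hmeas j,
        (hasFiniteIntegral_iff_ofReal (.of_forall hsum0)).2 (hle.trans_lt ENNReal.ofReal_lt_top)⟩
    have hint (j) : IntegrableOn (fun p : (Fin d → ℝ) × ℝ =>
        (pderiv' (fun y => u y p.2) j p.1) ^ 2) (Ω ×ˢ Ioo 0 T) := by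
      refine hsum.mono' (hmeas j) (.of_forall fun p => ?_)
      rw [Real.norm_of_nonneg (sq_nonneg _)]
      exact Finset.single_le_sum (f := fun j => (pderiv' (fun y => u y p.2) j p.1) ^ 2)
        (fun i _ => sq_nonneg _) (Finset.mem_univ j)
    have hnn : 0 ≤ (∫ x in Ω, (u₀ x) ^ 2 / 2) / (ε * δ) :=
      div_nonneg (integral_nonneg fun x => by positivity) (mul_pos hε hδ).le
    have hreal : ∫ p in Ω ×ˢ Ioo 0 T, ∑ j, (pderiv' (fun y => u y p.2) j p.1) ^ 2
        ≤ (∫ x in Ω, (u₀ x) ^ 2 / 2) / (ε * δ) := by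
      rw [integral_eq_lintegral_of_nonneg_ae (.of_forall hsum0) hsum.aestronglyMeasurable]
      exact ENNReal.toReal_le_of_le_ofReal hnn hle
    rw [← integral_finsetSum _ fun j _ => hint j]
    refine (mul_le_mul_of_nonneg_left hreal hε.le).trans_eq ?_
    rw [integral_div]
    field_simp
  · have hbound : ∫ x in Ω, (u₀ x) ^ 2 ≤ A ^ 2 * (volume Ω).toReal := by
      refine (Real.le_norm_self _).trans
        (norm_setIntegral_le_of_norm_le_const hΩbd.measure_lt_top fun x _ => ?_)
      rw [norm_pow, Real.norm_eq_abs]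
      exact pow_le_pow_left₀ (abs_nonneg _) (hu₀A x) 2
    rw [mul_assoc]
    exact mul_le_mul_of_nonneg_left hbound (by positivity)
end
end

section
/- Let Ω ⊆ ℝ^d be a bounded open set with smooth boundary, T > 0, ε > 0 and δ > 0. Let f = (f₁,…,f_d) with each f_j ∈ C²(ℝ) and f_j′ bounded, let B ∈ C¹(ℝ) be bounded with B ≥ 0, and let u be a classical solution of the regularized viscosity problem with flux f, viscosity coefficient B + δ, parameter ε and data u₀ ∈ C_c^∞(Ω). Then for every c ∈ ℝ and every φ ∈ C_c^∞(Ω_T): ∫_{Ω_T} |u − c| ∂_tφ dx dt + Σ_{j=1}^d ∫_{Ω_T} sg(u − c)(f_j(u) − f_j(c)) ∂_{x_j}φ dx dt + ε ∫_{Ω_T} sg(u − c) ( Σ_{j=1}^d ∂_{x_j}((B(u)+δ) ∂_{x_j}u) ) φ dx dt = 0. -/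
open MeasureTheory Set

noncomputable section

/-- A smooth approximation of the sign function, for large `n`. -/
def arctanSign (n : ℕ) (s : ℝ) : ℝ :=
  2 / Real.pi * Real.arctan (n * s)

/-- The derivative of `arctanSign n`. -/
def arctanSignDeriv (n : ℕ) (s : ℝ) : ℝ :=
  2 / Real.pi * (n / (1 + (n * s) ^ 2))

lemma hasDerivAt_arctanSign (n : ℕ) (s : ℝ) :
    HasDerivAt (arctanSign n) (arctanSignDeriv n s) s := by
  have h := (((hasDerivAt_id s).const_mul (n : ℝ)).arctan).const_mul (2 / Real.pi)
  refine h.congr_deriv ?_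
  simp only [arctanSignDeriv, id]
  ring

lemma continuous_arctanSign (n : ℕ) : Continuous (arctanSign n) :=
  continuous_iff_continuousAt.2 fun s => (hasDerivAt_arctanSign n s).continuousAt

lemma continuous_arctanSignDeriv (n : ℕ) : Continuous (arctanSignDeriv n) := by
  unfold arctanSignDeriv
  refine continuous_const.mul (continuous_const.div (by fun_prop) fun s => ?_)
  positivity

lemma abs_arctanSign_le (n : ℕ) (s : ℝ) : |arctanSign n s| ≤ 1 := by
  have hpi := Real.pi_pos
  have h1 := Real.arctan_lt_pi_div_two (n * s)
  have h2 := Real.neg_pi_div_two_lt_arctan (n * s)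
  rw [arctanSign, abs_mul, abs_of_pos (by positivity : 0 < 2 / Real.pi), div_mul_eq_mul_div,
    div_le_one hpi]
  have := abs_le.2 ⟨h2.le, h1.le⟩
  linarith

lemma abs_arctanSignDeriv_mul_le (n : ℕ) (s : ℝ) : |arctanSignDeriv n s| * |s| ≤ 1 := by
  have hpi := Real.pi_gt_three
  have h1 : 2 / Real.pi ≤ 1 := by rw [div_le_one (by linarith)]; linarith
  have h2 : n / (1 + (n * s) ^ 2) * |s| ≤ 1 := by
    rw [div_mul_eq_mul_div, div_le_one (by positivity), ← sq_abs (n * s), abs_mul, Nat.abs_cast]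
    nlinarith [sq_nonneg ((n : ℝ) * |s| - 1), sq_nonneg ((n : ℝ) * |s|)]
  have h3 : 0 ≤ arctanSignDeriv n s := by unfold arctanSignDeriv; positivity
  rw [abs_of_nonneg h3, arctanSignDeriv, mul_assoc]
  exact mul_le_one₀ h1 (by positivity) h2

lemma tendsto_arctanSign (s : ℝ) :
    Filter.Tendsto (fun n => arctanSign n s) Filter.atTop (nhds (Real.sign s)) := by
  have hcast := tendsto_natCast_atTop_atTop (R := ℝ)
  have hpi := Real.pi_ne_zero
  rcases lt_trichotomy s 0 with h | rfl | h
  · have h1 := (tendsto_nhdsWithin_iff.1 Real.tendsto_arctan_atBot).1.comp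
      (hcast.atTop_mul_const_of_neg h)
    have h2 := h1.const_mul (2 / Real.pi)
    rw [Real.sign_of_neg h]
    rw [show (-1 : ℝ) = 2 / Real.pi * -(Real.pi / 2) by field_simp]
    exact h2
  · simp [arctanSign]
  · have h1 := (tendsto_nhdsWithin_iff.1 Real.tendsto_arctan_atTop).1.comp
      (hcast.atTop_mul_const h)
    have h2 := h1.const_mul (2 / Real.pi)
    rw [Real.sign_of_pos h]
    rw [show (1 : ℝ) = 2 / Real.pi * (Real.pi / 2) by field_simp]
    exact h2

lemma tendsto_arctanSignDeriv {s : ℝ} (hs : s ≠ 0) :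
    Filter.Tendsto (fun n => arctanSignDeriv n s) Filter.atTop (nhds 0) := by
  have h1 : Filter.Tendsto (fun n : ℕ => (s ^ 2)⁻¹ * (n : ℝ)⁻¹) Filter.atTop (nhds 0) := by
    simpa using (tendsto_inv_atTop_nhds_zero_nat (𝕜 := ℝ)).const_mul ((s ^ 2)⁻¹)
  have h2 : Filter.Tendsto (fun n : ℕ => (n : ℝ) / (1 + (n * s) ^ 2)) Filter.atTop (nhds 0) := by
    refine squeeze_zero (fun n => by positivity) (fun n => ?_) h1
    rcases Nat.eq_zero_or_pos n with rfl | hn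
    · simp
    · have hn' : (0 : ℝ) < n := by exact_mod_cast hn
      rw [← mul_inv, div_le_iff₀ (by positivity), inv_mul_eq_div, le_div_iff₀ (by positivity)]
      nlinarith
  simpa [arctanSignDeriv] using h2.const_mul (2 / Real.pi)

lemma integrable_mul_of_continuousOn_of_tsupport_subset {E : Type*}
    [TopologicalSpace E] [T2Space E]
    [MeasurableSpace E] [BorelSpace E]
    {μ : Measure E} [IsFiniteMeasureOnCompacts μ] {U : Set E} {h χ : E → ℝ}
    (hh : ContinuousOn h U) (hχ : Continuous χ) (hχc : HasCompactSupport χ)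
    (hχU : tsupport χ ⊆ U) : Integrable (fun x => h x * χ x) μ := by
  have h1 : IntegrableOn (fun x => h x * χ x) (tsupport χ) μ :=
    ((hh.mono hχU).mul hχ.continuousOn).integrableOn_compact hχc
  refine (integrableOn_iff_integrable_of_support_subset fun x hx => ?_).1 h1
  exact subset_tsupport χ fun h0 => hx (by simp [h0])

/-- Integration by parts for a function that is only differentiable near the support of the test
function. -/
lemma integral_mul_fderiv_eq_neg_of_tsupport_subset {E : Type*}
    [NormedAddCommGroup E] [NormedSpace ℝ E] [FiniteDimensional ℝ E] [MeasurableSpace E]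
    [BorelSpace E] {μ : Measure E} [μ.IsAddHaarMeasure] {U : Set E} {v : E} {w w' φ : E → ℝ}
    (hw : ContinuousOn w U) (hw' : ContinuousOn w' U)
    (hd : ∀ x ∈ U, HasLineDerivAt ℝ w (w' x) x v)
    (hφ : ContDiff ℝ 1 φ) (hφc : HasCompactSupport φ) (hφU : tsupport φ ⊆ U) :
    ∫ x, w x * fderiv ℝ φ x v ∂μ = - ∫ x, w' x * φ x ∂μ := by
  have hφ' : Continuous fun x => fderiv ℝ φ x v :=
    (hφ.continuous_fderiv one_ne_zero).clm_apply continuous_const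
  exact integral_bilinear_hasLineDerivAt_right_eq_neg_left_of_integrable
    (B := ContinuousLinearMap.mul ℝ ℝ)
    (integrable_mul_of_continuousOn_of_tsupport_subset hw' hφ.continuous hφc hφU)
    (integrable_mul_of_continuousOn_of_tsupport_subset hw hφ' (hφc.fderiv_apply ℝ v)
      ((tsupport_fderiv_apply_subset ℝ v).trans hφU))
    (integrable_mul_of_continuousOn_of_tsupport_subset hw hφ.continuous hφc hφU)
    (fun x hx => hd x (hφU hx))
    (fun x _ => ((hφ.differentiable one_ne_zero x).hasFDerivAt).hasLineDerivAt v)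

/-- Kruzhkov's chain rule `∂ᵥ (sg(w - c) (g(w) - g(c))) = sg(w - c) g'(w) ∂ᵥ w` in the sense of
distributions. -/
lemma integral_sign_mul_fderiv_eq_neg {E : Type*}
    [NormedAddCommGroup E] [NormedSpace ℝ E] [FiniteDimensional ℝ E] [MeasurableSpace E]
    [BorelSpace E] {μ : Measure E} [μ.IsAddHaarMeasure] {U : Set E} {v : E} {w w' φ : E → ℝ}
    (hw : ContinuousOn w U) (hw' : ContinuousOn w' U)
    (hd : ∀ x ∈ U, HasLineDerivAt ℝ w (w' x) x v)
    (hφ : ContDiff ℝ 1 φ) (hφc : HasCompactSupport φ) (hφU : tsupport φ ⊆ U)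
    {g g' : ℝ → ℝ} (hg : ∀ y, HasDerivAt g (g' y) y) (hg' : Continuous g')
    {C : ℝ} (hC : ∀ y, |g' y| ≤ C) (c : ℝ) :
    Integrable (fun x => Real.sign (w x - c) * (g' (w x) * w' x) * φ x) μ ∧
    ∫ x, Real.sign (w x - c) * (g (w x) - g c) * fderiv ℝ φ x v ∂μ
      = - ∫ x, Real.sign (w x - c) * (g' (w x) * w' x) * φ x ∂μ := by
  have hgc : Continuous g := continuous_iff_continuousAt.2 fun s => (hg s).continuousAt
  have hlip : ∀ y, |g y - g c| ≤ C * |y - c| := fun y => by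
    simpa using Convex.norm_image_sub_le_of_norm_hasDerivWithin_le
      (f := g) (f' := g') (s := univ) (x := c) (y := y) (C := C)
      (fun x _ => (hg x).hasDerivWithinAt) (fun x _ => hC x) convex_univ (mem_univ _) (mem_univ _)
  have hC0 : 0 ≤ C := (abs_nonneg _).trans (hC 0)
  have hφ' : Continuous fun x => fderiv ℝ φ x v :=
    (hφ.continuous_fderiv one_ne_zero).clm_apply continuous_const
  have hφ'c := hφc.fderiv_apply ℝ v
  have hφ'U : tsupport (fun x => fderiv ℝ φ x v) ⊆ U :=
    (tsupport_fderiv_apply_subset ℝ v).trans hφU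
  set W : ℕ → E → ℝ := fun n x => arctanSign n (w x - c) * (g (w x) - g c)
  set W' : ℕ → E → ℝ := fun n x =>
    (arctanSignDeriv n (w x - c) * (g (w x) - g c) + arctanSign n (w x - c) * g' (w x)) * w' x
  have hsub : ContinuousOn (fun x => w x - c) U := hw.sub continuousOn_const
  have hgsub : ContinuousOn (fun x => g (w x) - g c) U :=
    (hgc.comp_continuousOn hw).sub continuousOn_const
  have hWc : ∀ n, ContinuousOn (W n) U := fun n =>
    ((continuous_arctanSign n).comp_continuousOn hsub).mul hgsub
  have hW'c : ∀ n, ContinuousOn (W' n) U := fun n =>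
    ((((continuous_arctanSignDeriv n).comp_continuousOn hsub).mul hgsub).add
      (((continuous_arctanSign n).comp_continuousOn hsub).mul (hg'.comp_continuousOn hw))).mul hw'
  have hWd : ∀ n, ∀ x ∈ U, HasLineDerivAt ℝ (W n) (W' n x) x v := by
    intro n x hx
    have h1 : HasDerivAt (fun s => arctanSign n (s - c) * (g s - g c))
        (arctanSignDeriv n (w x - c) * (g (w x) - g c) + arctanSign n (w x - c) * g' (w x))
        (w x) :=
      ((hasDerivAt_arctanSign n (w x - c)).comp_sub_const (w x) c).mul ((hg (w x)).sub_const (g c))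
    exact h1.comp_of_eq (0 : ℝ) (hd x hx) (by simp)
  have hparts := fun n =>
    integral_mul_fderiv_eq_neg_of_tsupport_subset (μ := μ) (hWc n) (hW'c n) (hWd n) hφ hφc hφU
  have hlimW : ∀ x, Filter.Tendsto (fun n => W n x * fderiv ℝ φ x v) Filter.atTop
      (nhds (Real.sign (w x - c) * (g (w x) - g c) * fderiv ℝ φ x v)) := fun x =>
    ((tendsto_arctanSign (w x - c)).mul_const _).mul_const _
  have hlimW' : ∀ x, Filter.Tendsto (fun n => W' n x * φ x) Filter.atTop
      (nhds (Real.sign (w x - c) * (g' (w x) * w' x) * φ x)) := by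
    intro x
    have h1 : Filter.Tendsto (fun n => arctanSignDeriv n (w x - c) * (g (w x) - g c))
        Filter.atTop (nhds 0) := by
      by_cases h : w x = c
      · simp [h]
      · simpa using (tendsto_arctanSignDeriv (sub_ne_zero.2 h)).mul_const (g (w x) - g c)
    have h2 := (((h1.add ((tendsto_arctanSign (w x - c)).mul_const (g' (w x)))).mul_const
      (w' x)).mul_const (φ x))
    rwa [zero_add, mul_assoc (Real.sign _)] at h2
  have hboundW : ∀ n x, ‖W n x * fderiv ℝ φ x v‖ ≤ ‖(g (w x) - g c) * fderiv ℝ φ x v‖ := by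
    intro n x
    rw [norm_mul, norm_mul, norm_mul]
    gcongr
    exact mul_le_of_le_one_left (norm_nonneg _) (abs_arctanSign_le n _)
  have hboundW' : ∀ n x, ‖W' n x * φ x‖ ≤ 2 * C * ‖w' x * φ x‖ := by
    intro n x
    have h1 : |arctanSignDeriv n (w x - c) * (g (w x) - g c)| ≤ C := by
      rw [abs_mul]
      calc _ ≤ |arctanSignDeriv n (w x - c)| * (C * |w x - c|) := by gcongr; exact hlip _
        _ = C * (|arctanSignDeriv n (w x - c)| * |w x - c|) := by ring
        _ ≤ C := mul_le_of_le_one_right hC0 (abs_arctanSignDeriv_mul_le n _)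
    have h2 : |arctanSign n (w x - c) * g' (w x)| ≤ C := by
      rw [abs_mul]
      exact (mul_le_of_le_one_left (abs_nonneg _) (abs_arctanSign_le n _)).trans (hC _)
    rw [norm_mul, norm_mul, norm_mul, ← mul_assoc]
    gcongr
    exact (abs_add_le _ _).trans (by linarith)
  have hintW := fun n => integrable_mul_of_continuousOn_of_tsupport_subset (μ := μ)
    (hWc n) hφ' hφ'c hφ'U
  have hintW' := fun n => integrable_mul_of_continuousOn_of_tsupport_subset (μ := μ)
    (hW'c n) hφ.continuous hφc hφU
  have hintb := (integrable_mul_of_continuousOn_of_tsupport_subset (μ := μ)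
    hgsub hφ' hφ'c hφ'U).norm
  have hintb' := (integrable_mul_of_continuousOn_of_tsupport_subset (μ := μ)
    hw' hφ.continuous hφc hφU).norm.const_mul (2 * C)
  have hlim := tendsto_integral_of_dominated_convergence _ (fun n => (hintW n).aestronglyMeasurable)
    hintb (fun n => ae_of_all _ (hboundW n)) (ae_of_all _ hlimW)
  have hlim' := tendsto_integral_of_dominated_convergence _
    (fun n => (hintW' n).aestronglyMeasurable)
    hintb' (fun n => ae_of_all _ (hboundW' n)) (ae_of_all _ hlimW')
  refine ⟨?_, tendsto_nhds_unique hlim (by simpa only [hparts] using hlim'.neg)⟩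
  exact hintb'.mono' (aestronglyMeasurable_of_tendsto_ae Filter.atTop
    (fun n => (hintW' n).aestronglyMeasurable) (ae_of_all _ hlimW'))
    (ae_of_all _ fun x => le_of_tendsto (hlimW' x).norm
      (Filter.Eventually.of_forall fun n => hboundW' n x))

lemma hasLineDerivAt_snd {E : Type*} [NormedAddCommGroup E] [NormedSpace ℝ E] {u : E → ℝ → ℝ}
    {q : E × ℝ} (h : DifferentiableAt ℝ (u q.1) q.2) :
    HasLineDerivAt ℝ (fun p : E × ℝ => u p.1 p.2) (deriv (u q.1) q.2) q (0, 1) := by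
  have h1 : HasLineDerivAt ℝ (u q.1) (fderiv ℝ (u q.1) q.2 1) q.2 1 :=
    h.hasFDerivAt.hasLineDerivAt 1
  simpa [HasLineDerivAt] using h1

lemma hasLineDerivAt_fst {E F : Type*} [NormedAddCommGroup E] [NormedSpace ℝ E]
    [NormedAddCommGroup F] [NormedSpace ℝ F] {u : E → F → ℝ}
    {q : E × F} (h : DifferentiableAt ℝ (fun y => u y q.2) q.1) (v : E) :
    HasLineDerivAt ℝ (fun p : E × F => u p.1 p.2) (fderiv ℝ (fun y => u y q.2) q.1 v) q (v, 0) := by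
  have h1 := h.hasFDerivAt.hasLineDerivAt v
  simpa [HasLineDerivAt] using h1

/-- **Kruzhkov entropy identity for the regularized problem**: for every `c ∈ ℝ` and every
test function `φ ∈ C_c^∞(Ω_T)`,
`∫ |u−c| ∂ₜφ + Σⱼ ∫ sg(u−c)(fⱼ(u)−fⱼ(c)) ∂ⱼφ + ε ∫ sg(u−c)(Σⱼ ∂ⱼ((B(u)+δ)∂ⱼu)) φ = 0`. -/
theorem kruzhkov_entropy_identity
    (d : ℕ) (Ω : Set (Fin d → ℝ)) (hΩopen : IsOpen Ω) (hΩbd : Bornology.IsBounded Ω)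
    (T ε δ : ℝ) (hT : 0 < T) (hε : 0 < ε) (hδ : 0 < δ)
    (f : Fin d → ℝ → ℝ) (hf : ∀ j, ContDiff ℝ 2 (f j))
    (hf' : ∀ j, ∃ C, ∀ y : ℝ, |deriv (f j) y| ≤ C)
    (B : ℝ → ℝ) (hB : ContDiff ℝ 1 B) (hBbd : ∃ C, ∀ y : ℝ, |B y| ≤ C)
    (hBnonneg : ∀ y : ℝ, 0 ≤ B y)
    (u₀ : (Fin d → ℝ) → ℝ) (hu₀smooth : ContDiff ℝ (⊤ : ℕ∞) u₀)
    (hu₀supp : HasCompactSupport u₀) (hu₀Ω : tsupport u₀ ⊆ Ω)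
    (u : (Fin d → ℝ) → ℝ → ℝ) (hu : IsClassicalSolution Ω T ε δ f B u₀ u) :
    ∀ c : ℝ, ∀ φ : (Fin d → ℝ) × ℝ → ℝ, ContDiff ℝ (⊤ : ℕ∞) φ → HasCompactSupport φ →
      tsupport φ ⊆ Ω ×ˢ Set.Ioo 0 T →
      (∫ q in Ω ×ˢ Set.Ioo 0 T, |u q.1 q.2 - c| * fderiv ℝ φ q (0, 1)) +
        (∑ j, ∫ q in Ω ×ˢ Set.Ioo 0 T,
          Real.sign (u q.1 q.2 - c) * (f j (u q.1 q.2) - f j c) *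
            fderiv ℝ φ q (Pi.single j 1, 0)) +
        ε * ∫ q in Ω ×ˢ Set.Ioo 0 T,
          Real.sign (u q.1 q.2 - c) *
            (∑ j, pderiv' (fun y => (B (u y q.2) + δ) * pderiv' (fun z => u z q.2) j y) j q.1) *
            φ q
        = 0 := by
  intro c φ hφ hφc hφU
  set U : Set ((Fin d → ℝ) × ℝ) := Ω ×ˢ Set.Ioo 0 T with hU
  have hφ1 : ContDiff ℝ 1 φ := hφ.of_le (by exact_mod_cast le_top)
  have hw : ContinuousOn (fun p : (Fin d → ℝ) × ℝ => u p.1 p.2) U :=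
    hu.cont.mono (Set.prod_mono subset_closure Set.Ioo_subset_Icc_self)
  have hUmeas : MeasurableSet U := hΩopen.measurableSet.prod measurableSet_Ioo
  have hφ0 : ∀ q, q ∉ U → φ q = 0 := fun q hq =>
    image_eq_zero_of_notMem_tsupport fun h => hq (hφU h)
  have hφ'0 : ∀ v q, q ∉ U → fderiv ℝ φ q v = 0 := fun v q hq => by
    rw [image_eq_zero_of_notMem_tsupport fun h => hq (hφU (tsupport_fderiv_subset ℝ h))]
    rfl
  have : (volume : Measure ((Fin d → ℝ) × ℝ)).IsAddHaarMeasure :=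
    Measure.prod.instIsAddHaarMeasure volume volume
  obtain ⟨hit, ht⟩ := integral_sign_mul_fderiv_eq_neg
    (μ := (volume : Measure ((Fin d → ℝ) × ℝ))) hw hu.cont_dt
    (fun q hq => hasLineDerivAt_snd (hu.diff_t q.1 hq.1 q.2 hq.2)) hφ1 hφc hφU
    (g := id) (g' := fun _ => 1) hasDerivAt_id continuous_const (C := 1) (by simp) c
  have hx : ∀ j, _ := fun j => integral_sign_mul_fderiv_eq_neg
    (μ := (volume : Measure ((Fin d → ℝ) × ℝ))) hw (hu.cont_dx j)
    (fun q hq => hasLineDerivAt_fst (hu.diff_x q.1 hq.1 q.2 hq.2) (Pi.single j 1)) hφ1 hφc hφU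
    (g := f j) (g' := deriv (f j))
    (fun y => ((hf j).differentiable two_ne_zero y).hasDerivAt)
    ((hf j).continuous_deriv one_le_two) (hf' j).choose_spec c
  have hpde : ∀ q ∈ U, ε * (Real.sign (u q.1 q.2 - c) *
        (∑ j, pderiv' (fun y => (B (u y q.2) + δ) * pderiv' (fun z => u z q.2) j y) j q.1) * φ q)
      = Real.sign (u q.1 q.2 - c) * (1 * deriv (u q.1) q.2) * φ q +
        ∑ j, Real.sign (u q.1 q.2 - c) *
          (deriv (f j) (u q.1 q.2) * pderiv' (fun y => u y q.2) j q.1) * φ q := by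
    intro q hq
    have hchain : ∀ j, pderiv' (fun y => f j (u y q.2)) j q.1
        = deriv (f j) (u q.1 q.2) * pderiv' (fun y => u y q.2) j q.1 := by
      intro j
      have h := ((hf j).differentiable two_ne_zero (u q.1 q.2)).hasDerivAt.comp_hasFDerivAt q.1
        (hu.diff_x q.1 hq.1 q.2 hq.2).hasFDerivAt
      have h' : fderiv ℝ (fun y => f j (u y q.2)) q.1 = _ := h.fderiv
      simp [pderiv', h']
    have h := hu.pde q.1 hq.1 q.2 hq.2
    simp only [hchain] at h
    rw [← Finset.sum_mul, ← Finset.mul_sum, ← add_mul, ← mul_add, one_mul, h]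
    ring
  have habs : ∀ s : ℝ, |s| = Real.sign s * s := fun s => by
    rcases lt_trichotomy s 0 with h | rfl | h
    · rw [Real.sign_of_neg h, abs_of_neg h]; ring
    · simp
    · rw [Real.sign_of_pos h, abs_of_pos h]; ring
  have e1 : ∫ q in U, |u q.1 q.2 - c| * fderiv ℝ φ q (0, 1)
      = - ∫ q, Real.sign (u q.1 q.2 - c) * (1 * deriv (u q.1) q.2) * φ q := by
    rw [setIntegral_eq_integral_of_forall_compl_eq_zero fun q hq => by rw [hφ'0 _ q hq, mul_zero],
      ← ht]
    simp only [habs, id]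
  have e2 : ∀ j, ∫ q in U, Real.sign (u q.1 q.2 - c) * (f j (u q.1 q.2) - f j c) *
        fderiv ℝ φ q (Pi.single j 1, 0)
      = - ∫ q, Real.sign (u q.1 q.2 - c) *
          (deriv (f j) (u q.1 q.2) * pderiv' (fun y => u y q.2) j q.1) * φ q := fun j => by
    rw [setIntegral_eq_integral_of_forall_compl_eq_zero fun q hq => by rw [hφ'0 _ q hq, mul_zero]]
    exact (hx j).2
  rw [e1, Finset.sum_congr rfl fun j _ => e2 j, Finset.sum_neg_distrib, ← integral_const_mul,
    setIntegral_congr_fun hUmeas hpde,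
    setIntegral_eq_integral_of_forall_compl_eq_zero fun q hq => by simp [hφ0 q hq],
    integral_add hit (integrable_finsetSum _ fun j _ => (hx j).1),
    integral_finsetSum _ fun j _ => (hx j).1]
  ring
end
end

section
/- Let Ω ⊆ ℝ^d be a bounded open set with smooth boundary, T > 0, ε > 0 and δ > 0. Let f = (f₁,…,f_d) with each f_j ∈ C²(ℝ) and f_j′ bounded, let B ∈ C¹(ℝ) be bounded with B ≥ 0, and let u be a classical solution of the regularized viscosity problem with flux f, viscosity coefficient B + δ, parameter ε and data u₀ ∈ C_c^∞(Ω). Then for every φ ∈ C_c^∞(Ω × ℝ × (0,T)): ∫_{Ω×ℝ×(0,T)} χ_u(x,t,c) ( ∂_tφ(x,c,t) + Σ_{j=1}^d f_j′(c) ∂_{x_j}φ(x,c,t) ) dx dc dt = (ε/2) ∫_{Ω×ℝ×(0,T)} sg(u(x,t) − c) ( Σ_{j=1}^d ∂_{x_j}((B(u)+δ) ∂_{x_j}u)(x,t) ) ∂_cφ(x,c,t) dx dc dt. In particular, χ_u satisfies the kinetic equation ∂_t χ + Σ_j f_j′(c) ∂_{x_j}χ = ∂_c( (ε/2) sg(u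 − c) Σ_j ∂_{x_j}((B(u)+δ)∂_{x_j}u) ) in the sense of distributions on Ω × ℝ × (0,T). -/
open MeasureTheory Set

noncomputable section

/-- The kinetic function `χ_u(x,t,c)` associated with `u`. -/
def kineticChi {d : ℕ} (u : (Fin d → ℝ) → ℝ → ℝ) (x : Fin d → ℝ) (t c : ℝ) : ℝ :=
  if u x t < c ∧ c < 0 then 1 else if 0 < c ∧ c < u x t then -1 else 0

open Filter Topology

/-- Differentiation under the integral sign for a `C¹` integrand on a bounded interval. -/
theorem hasDerivAt_intervalIntegral_of_contDiff {b : ℝ × ℝ → ℝ} (hb : ContDiff ℝ 1 b) (y s : ℝ) :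
    HasDerivAt (fun r => ∫ c in (0 : ℝ)..y, b (r, c))
      (∫ c in (0 : ℝ)..y, fderiv ℝ b (s, c) (1, 0)) s := by
  have hcont : Continuous fun q => fderiv ℝ b q (1, 0) :=
    (hb.continuous_fderiv one_ne_zero).clm_apply continuous_const
  have hbc := hb.continuous
  obtain ⟨C, hC⟩ := ((isCompact_closedBall s 1).prod (isCompact_uIcc (a := (0 : ℝ)) (b := y))
    ).exists_bound_of_continuousOn hcont.continuousOn
  refine (intervalIntegral.hasDerivAt_integral_of_dominated_loc_of_deriv_le
    (F := fun r c => b (r, c)) (F' := fun r c => fderiv ℝ b (r, c) (1, 0)) (bound := fun _ => C)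
    (Metric.closedBall_mem_nhds s one_pos) ?_ ?_ ?_ ?_ ?_ ?_).2
  · exact Eventually.of_forall fun r => Continuous.aestronglyMeasurable (by fun_prop)
  · exact Continuous.intervalIntegrable (by fun_prop) _ _
  · exact (hcont.comp (by fun_prop : Continuous fun c : ℝ => (s, c))).aestronglyMeasurable
  · exact Eventually.of_forall fun c hc r hr => hC (r, c) ⟨hr, uIoc_subset_uIcc hc⟩
  · exact intervalIntegrable_const
  · refine Eventually.of_forall fun c _ r _ => ?_
    exact ((hb.differentiable one_ne_zero) (r, c)).hasFDerivAt.comp_hasDerivAt r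
      ((hasDerivAt_id r).prodMk (hasDerivAt_const r c))

/-- Leibniz rule with a variable upper limit for a `C¹` integrand. -/
theorem hasDerivAt_intervalIntegral_upper {b : ℝ × ℝ → ℝ} (hb : ContDiff ℝ 1 b)
    {v : ℝ → ℝ} {v' s : ℝ} (hv : HasDerivAt v v' s) :
    HasDerivAt (fun r => ∫ c in (0 : ℝ)..v r, b (r, c))
      (b (s, v s) * v' + ∫ c in (0 : ℝ)..v s, fderiv ℝ b (s, c) (1, 0)) s := by
  have hcont : Continuous fun q => fderiv ℝ b q (1, 0) :=
    (hb.continuous_fderiv one_ne_zero).clm_apply continuous_const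
  have hbc := hb.continuous
  have h1 : Continuous fun q : ℝ × ℝ => ∫ c in (0 : ℝ)..q.2, fderiv ℝ b (q.1, c) (1, 0) :=
    intervalIntegral.continuous_parametric_primitive_of_continuous
      (f := fun r c => fderiv ℝ b (r, c) (1, 0)) hcont
  have key := hasStrictFDerivAt_uncurry_coprod (𝕜 := ℝ) (u := (s, v s))
    (f := fun r y => ∫ c in (0 : ℝ)..y, b (r, c))
    (f₁ := fun r y =>
      ContinuousLinearMap.toSpanSingleton ℝ (∫ c in (0 : ℝ)..y, fderiv ℝ b (r, c) (1, 0)))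
    (f₂ := fun r y => ContinuousLinearMap.toSpanSingleton ℝ (b (r, y)))
    (Eventually.of_forall fun q => (hasDerivAt_intervalIntegral_of_contDiff hb q.2 q.1).hasFDerivAt)
    (Eventually.of_forall fun q => (intervalIntegral.integral_hasDerivAt_right
      (Continuous.intervalIntegrable (by fun_prop) _ _)
      (Continuous.stronglyMeasurableAtFilter (by fun_prop) _ _)
      (Continuous.continuousAt (by fun_prop))).hasFDerivAt)
    (((ContinuousLinearMap.toSpanSingletonCLE (𝕜 := ℝ) (E := ℝ)).continuous.comp h1).continuousAt)
    (((ContinuousLinearMap.toSpanSingletonCLE (𝕜 := ℝ) (E := ℝ)).continuous.comp hbc).continuousAt)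
  have := key.hasFDerivAt.comp_hasDerivAt s ((hasDerivAt_id s).prodMk hv)
  convert! this using 1
  simp [Function.HasUncurry.uncurry]
  ring

/-- Leibniz rule with a variable upper limit, in a direction `w` of the parameter space. -/
theorem hasLineDerivAt_intervalIntegral_upper {P : Type*} [NormedAddCommGroup P] [NormedSpace ℝ P]
    {a : P × ℝ → ℝ} (ha : ContDiff ℝ 1 a) {u : P → ℝ} {u' : ℝ} {p w : P}
    (hu : HasLineDerivAt ℝ u u' p w) :
    HasLineDerivAt ℝ (fun p => ∫ c in (0 : ℝ)..u p, a (p, c))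
      (a (p, u p) * u' + ∫ c in (0 : ℝ)..u p, fderiv ℝ a (p, c) (w, 0)) p w := by
  have hb : ContDiff ℝ 1 fun q : ℝ × ℝ => a (p + q.1 • w, q.2) := by fun_prop
  have key := hasDerivAt_intervalIntegral_upper hb hu
  have hder (c : ℝ) : fderiv ℝ (fun q : ℝ × ℝ => a (p + q.1 • w, q.2)) (0, c) (1, 0)
      = fderiv ℝ a (p, c) (w, 0) := by
    have h1 : HasFDerivAt a (fderiv ℝ a (p, c)) (p + (0 : ℝ) • w, c) := by
      simpa using ((ha.differentiable one_ne_zero) (p, c)).hasFDerivAt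
    have h2 : HasDerivAt (fun r : ℝ => a (p + r • w, c)) (fderiv ℝ a (p, c) (w, 0)) 0 := by
      refine h1.comp_hasDerivAt (0 : ℝ) (HasDerivAt.prodMk ?_ (hasDerivAt_const _ _))
      simpa using ((hasDerivAt_id (0 : ℝ)).smul_const w).const_add p
    have h3 := ((hb.differentiable one_ne_zero) (0, c)).hasFDerivAt.comp_hasDerivAt (0 : ℝ)
      ((hasDerivAt_id (0 : ℝ)).prodMk (hasDerivAt_const _ c))
    exact h3.unique h2
  simpa [HasLineDerivAt, hder] using key

/-- A function continuous on a compact set and vanishing off it is integrable. -/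
theorem integrable_of_continuousOn_of_eq_zero {X : Type*} [TopologicalSpace X] [T2Space X]
    [MeasurableSpace X] [OpensMeasurableSpace X] {μ : Measure X} [IsFiniteMeasureOnCompacts μ]
    {g : X → ℝ} {K : Set X} (hK : IsCompact K) (hg : ContinuousOn g K) (h0 : ∀ x ∉ K, g x = 0) :
    Integrable g μ :=
  (hg.integrableOn_compact hK).integrable_of_forall_notMem_eq_zero h0

theorem integral_eq_zero_of_hasLineDerivAt {P : Type*} [NormedAddCommGroup P] [NormedSpace ℝ P]
    [FiniteDimensional ℝ P] [MeasurableSpace P] [BorelSpace P] {μ : Measure P}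
    [μ.IsAddHaarMeasure] {g g' : P → ℝ} {w : P} (hg : Integrable g μ) (hg' : Integrable g' μ)
    (h : ∀ p, HasLineDerivAt ℝ g (g' p) p w) : ∫ p, g' p ∂μ = 0 := by
  have := integral_bilinear_hasLineDerivAt_right_eq_neg_left_of_integrable (μ := μ) (v := w)
    (f := fun _ : P => (1 : ℝ)) (f' := fun _ => 0) (g := g) (g' := g')
    (B := ContinuousLinearMap.mul ℝ ℝ) (by simp) (by simpa using hg') (by simpa using hg)
    (fun p _ => hasDerivAt_const _ _) (fun p _ => h p)
  simpa using this

/-- Integrating a directional derivative of `p ↦ ∫ c in 0..u p, a (p, c)` gives zero when `a` is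
compactly supported in the parameter. -/
theorem integral_lineDeriv_intervalIntegral_upper {P : Type*} [NormedAddCommGroup P]
    [NormedSpace ℝ P] [FiniteDimensional ℝ P] [MeasurableSpace P] [BorelSpace P] {μ : Measure P}
    [μ.IsAddHaarMeasure] {a : P × ℝ → ℝ} (ha : ContDiff ℝ 1 a) {u u' : P → ℝ} {K O : Set P} {w : P}
    (hK : IsCompact K) (hKO : K ⊆ O) (ha0 : ∀ p ∉ K, ∀ c, a (p, c) = 0)
    (hu : ContinuousOn u O) (hu' : ContinuousOn u' O)
    (hd : ∀ p ∈ O, HasLineDerivAt ℝ u (u' p) p w) :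
    Integrable (fun p => a (p, u p) * u' p + ∫ c in (0 : ℝ)..u p, fderiv ℝ a (p, c) (w, 0)) μ ∧
    ∫ p, (a (p, u p) * u' p + ∫ c in (0 : ℝ)..u p, fderiv ℝ a (p, c) (w, 0)) ∂μ = 0 := by
  have hcont : Continuous fun q => fderiv ℝ a q (w, 0) :=
    (ha.continuous_fderiv one_ne_zero).clm_apply continuous_const
  have hac := ha.continuous
  have hfd : ∀ p ∉ K, ∀ c, fderiv ℝ a (p, c) (w, 0) = 0 := by
    intro p hp c
    have : a =ᶠ[𝓝 (p, c)] fun _ => 0 := by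
      have : (Kᶜ ×ˢ univ : Set (P × ℝ)) ∈ 𝓝 (p, c) :=
        (hK.isClosed.isOpen_compl.prod isOpen_univ).mem_nhds ⟨hp, mem_univ _⟩
      filter_upwards [this] with q hq using ha0 q.1 hq.1 q.2
    rw [this.fderiv_eq]; simp
  have huK := hu.mono hKO
  have hprim : ∀ {b : P × ℝ → ℝ}, Continuous b →
      ContinuousOn (fun p => ∫ c in (0 : ℝ)..u p, b (p, c)) K := fun {b} hb =>
    (intervalIntegral.continuous_parametric_primitive_of_continuous
      (f := fun p c => b (p, c)) hb).comp_continuousOn (continuousOn_id.prodMk huK)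
  have hI' : Integrable
      (fun p => a (p, u p) * u' p + ∫ c in (0 : ℝ)..u p, fderiv ℝ a (p, c) (w, 0)) μ := by
    refine integrable_of_continuousOn_of_eq_zero hK (.add (.mul ?_ (hu'.mono hKO)) (hprim hcont)) ?_
    · exact hac.comp_continuousOn (continuousOn_id.prodMk huK)
    · intro p hp
      simp [ha0 p hp, hfd p hp]
  refine ⟨hI', integral_eq_zero_of_hasLineDerivAt (w := w)
    (g := fun p => ∫ c in (0 : ℝ)..u p, a (p, c))
    (integrable_of_continuousOn_of_eq_zero hK (hprim hac) fun p hp => by simp [ha0 p hp]) hI' ?_⟩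
  intro p
  by_cases hp : p ∈ K
  · exact hasLineDerivAt_intervalIntegral_upper ha (hd p (hKO hp))
  · have h0 : (fun p => ∫ c in (0 : ℝ)..u p, a (p, c)) =ᶠ[𝓝 p] fun _ => 0 := by
      filter_upwards [hK.isClosed.isOpen_compl.mem_nhds hp] with q hq
      simp [ha0 q hq]
    have : HasFDerivAt (fun p => ∫ c in (0 : ℝ)..u p, a (p, c)) (0 : P →L[ℝ] ℝ) p :=
      (hasFDerivAt_const (0 : ℝ) p).congr_of_eventuallyEq h0
    simpa [ha0 p hp, hfd p hp] using this.hasLineDerivAt w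

instance {d : ℕ} : (volume : Measure ((Fin d → ℝ) × ℝ)).IsAddHaarMeasure :=
  inferInstanceAs ((volume : Measure (Fin d → ℝ)).prod (volume : Measure ℝ)).IsAddHaarMeasure

/-- Pairing with the kinetic function of the constant `v` is minus the primitive at `v`. -/
theorem integral_kineticSign_mul (v : ℝ) (g : ℝ → ℝ) :
    ∫ c, (if v < c ∧ c < 0 then 1 else if 0 < c ∧ c < v then -1 else 0) * g c
      = -∫ c in (0 : ℝ)..v, g c := by
  rcases le_or_gt 0 v with hv | hv
  · rw [intervalIntegral.integral_of_le hv, integral_Ioc_eq_integral_Ioo,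
      ← integral_indicator measurableSet_Ioo, ← integral_neg]
    congr 1 with c
    have h1 : ¬ (v < c ∧ c < 0) := fun h => by linarith [h.1, h.2]
    by_cases h2 : 0 < c ∧ c < v <;> simp [indicator, h1, h2]
  · rw [intervalIntegral.integral_of_ge hv.le, integral_Ioc_eq_integral_Ioo, neg_neg,
      ← integral_indicator measurableSet_Ioo]
    congr 1 with c
    have h1 : ¬ (0 < c ∧ c < v) := fun h => by linarith [h.1, h.2]
    by_cases h2 : v < c ∧ c < 0 <;> simp [indicator, h1, h2]

theorem integral_sign_sub_mul_deriv (v : ℝ) {g : ℝ → ℝ} (hg : ContDiff ℝ 1 g)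
    (hs : HasCompactSupport g) : ∫ c, Real.sign (v - c) * deriv g c = 2 * g v := by
  have hi : Integrable (deriv g) :=
    (hg.continuous_deriv le_rfl).integrable_of_hasCompactSupport hs.deriv
  have h1 : EqOn (fun c => Real.sign (v - c) * deriv g c) (deriv g) (Iio v) := fun c hc => by
    simp [Real.sign_of_pos (sub_pos.2 hc)]
  have h2 : EqOn (fun c => Real.sign (v - c) * deriv g c) (fun c => -deriv g c) (Ioi v) :=
    fun c hc => by simp [Real.sign_of_neg (sub_neg.2 hc)]
  have i1 : IntegrableOn (fun c => Real.sign (v - c) * deriv g c) (Iic v) := by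
    rw [integrableOn_Iic_iff_integrableOn_Iio]
    exact hi.integrableOn.congr_fun h1.symm measurableSet_Iio
  have i2 : IntegrableOn (fun c => Real.sign (v - c) * deriv g c) (Ioi v) :=
    hi.neg.integrableOn.congr_fun h2.symm measurableSet_Ioi
  rw [← intervalIntegral.integral_Iic_add_Ioi i1 i2, integral_Iic_eq_integral_Iio,
    setIntegral_congr_fun measurableSet_Iio h1, setIntegral_congr_fun measurableSet_Ioi h2,
    integral_neg, ← integral_Iic_eq_integral_Iio, hs.integral_Iic_deriv_eq hg,
    hs.integral_Ioi_deriv_eq hg]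
  ring

/-- Fubini's theorem, integrating the middle variable first. -/
theorem integral_prod_middle {X Y Z : Type*} [MeasureSpace X] [MeasureSpace Y] [MeasureSpace Z]
    [SFinite (volume : Measure X)] [SFinite (volume : Measure Y)] [SFinite (volume : Measure Z)]
    {F : X × Y × Z → ℝ} (hF : Integrable F) :
    Integrable (fun p : X × Z => ∫ c, F (p.1, c, p.2)) ∧
      ∫ q, F q = ∫ p : X × Z, ∫ c, F (p.1, c, p.2) := by
  let e : (X × Z) × Y ≃ᵐ X × Y × Z :=
    MeasurableEquiv.prodAssoc.trans ((MeasurableEquiv.refl X).prodCongr MeasurableEquiv.prodComm)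
  have he : MeasurePreserving e :=
    ((MeasurePreserving.id volume).prod Measure.measurePreserving_swap).comp
      volume_preserving_prodAssoc
  have hint : Integrable (fun r : (X × Z) × Y => F (r.1.1, r.2, r.1.2)) :=
    he.integrable_comp_of_integrable hF
  refine ⟨hint.integral_prod_left, ?_⟩
  rw [← he.integral_comp']
  exact integral_prod _ hint

theorem measurable_real_sign : Measurable Real.sign :=
  Measurable.ite measurableSet_Iio measurable_const
    (Measurable.ite measurableSet_Ioi measurable_const measurable_const)

/-- If `u` is continuous on an open set `O`, then `β (u (x, t)) c * g (x, c, t)` is integrable for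
bounded measurable `β` and integrable `g` vanishing over the complement of `O`. -/
theorem integrable_bdd_comp_mul {X : Type*} [MeasureSpace X] [TopologicalSpace X]
    [OpensMeasurableSpace (X × ℝ)]
    {O : Set (X × ℝ)} (hO : IsOpen O) {u : X × ℝ → ℝ} (hu : ContinuousOn u O) {β : ℝ × ℝ → ℝ}
    (hβ : Measurable β) (hβ1 : ∀ r, |β r| ≤ 1) {g : X × ℝ × ℝ → ℝ} (hg : Integrable g)
    (hg0 : ∀ q, (q.1, q.2.2) ∉ O → g q = 0) :
    Integrable fun q : X × ℝ × ℝ => β (u (q.1, q.2.2), q.2.1) * g q := by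
  classical
  have hU : Measurable (O.piecewise u 0) :=
    hu.measurable_piecewise continuousOn_const hO.measurableSet
  have hm : Measurable fun q : X × ℝ × ℝ => β (O.piecewise u 0 (q.1, q.2.2), q.2.1) := by
    fun_prop
  refine (hg.bdd_mul hm.aestronglyMeasurable (Eventually.of_forall fun q => hβ1 _)).congr
    (Eventually.of_forall fun q => ?_)
  by_cases hq : (q.1, q.2.2) ∈ O
  · simp [hq]
  · simp [hg0 q hq]

theorem fderiv_mul_comp_swap {X : Type*} [NormedAddCommGroup X] [NormedSpace ℝ X]
    {φ : X × ℝ × ℝ → ℝ} (hφ : Differentiable ℝ φ) {h : ℝ → ℝ} (hh : Differentiable ℝ h)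
    (p w : X × ℝ) (c : ℝ) :
    fderiv ℝ (fun r : (X × ℝ) × ℝ => h r.2 * φ (r.1.1, r.2, r.1.2)) (p, c) (w, 0)
      = h c * fderiv ℝ φ (p.1, c, p.2) (w.1, 0, w.2) := by
  have h1 : HasFDerivAt (fun r : (X × ℝ) × ℝ => h r.2)
      ((fderiv ℝ h c).comp (ContinuousLinearMap.snd ℝ (X × ℝ) ℝ)) (p, c) :=
    HasFDerivAt.comp (f := Prod.snd) (p, c) (hh c).hasFDerivAt hasFDerivAt_snd
  let L : (X × ℝ) × ℝ →L[ℝ] X × ℝ × ℝ :=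
    ((ContinuousLinearMap.fst ℝ X ℝ).comp (.fst ℝ (X × ℝ) ℝ)).prod
      ((ContinuousLinearMap.snd ℝ (X × ℝ) ℝ).prod
        ((ContinuousLinearMap.snd ℝ X ℝ).comp (.fst ℝ (X × ℝ) ℝ)))
  have h2 : HasFDerivAt (fun r : (X × ℝ) × ℝ => φ (r.1.1, r.2, r.1.2))
      ((fderiv ℝ φ (p.1, c, p.2)).comp L) (p, c) :=
    HasFDerivAt.comp (f := L) (p, c) (hφ (p.1, c, p.2)).hasFDerivAt L.hasFDerivAt
  have h3 : HasFDerivAt (fun r : (X × ℝ) × ℝ => h r.2 * φ (r.1.1, r.2, r.1.2)) _ (p, c) :=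
    h1.mul h2
  rw [h3.fderiv]
  simp [L]

/-- **Kinetic formulation for the regularized problem**: for every test function
`φ ∈ C_c^∞(Ω × ℝ × (0,T))` (coordinates `(x, c, t)`),
`∫ χ_u (∂ₜφ + Σⱼ fⱼ′(c) ∂ⱼφ) = (ε/2) ∫ sg(u−c)(Σⱼ ∂ⱼ((B(u)+δ)∂ⱼu)) ∂_cφ`,
i.e. `χ_u` solves the kinetic equation in the sense of distributions. -/
theorem kinetic_formulation
    (d : ℕ) (Ω : Set (Fin d → ℝ)) (hΩopen : IsOpen Ω) (hΩbd : Bornology.IsBounded Ω)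
    (T ε δ : ℝ) (hT : 0 < T) (hε : 0 < ε) (hδ : 0 < δ)
    (f : Fin d → ℝ → ℝ) (hf : ∀ j, ContDiff ℝ 2 (f j))
    (hf' : ∀ j, ∃ C, ∀ y : ℝ, |deriv (f j) y| ≤ C)
    (B : ℝ → ℝ) (hB : ContDiff ℝ 1 B) (hBbd : ∃ C, ∀ y : ℝ, |B y| ≤ C)
    (hBnonneg : ∀ y : ℝ, 0 ≤ B y)
    (u₀ : (Fin d → ℝ) → ℝ) (hu₀smooth : ContDiff ℝ (⊤ : ℕ∞) u₀)
    (hu₀supp : HasCompactSupport u₀) (hu₀Ω : tsupport u₀ ⊆ Ω)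
    (u : (Fin d → ℝ) → ℝ → ℝ) (hu : IsClassicalSolution Ω T ε δ f B u₀ u) :
    ∀ φ : (Fin d → ℝ) × ℝ × ℝ → ℝ, ContDiff ℝ (⊤ : ℕ∞) φ → HasCompactSupport φ →
      tsupport φ ⊆ Ω ×ˢ (Set.univ : Set ℝ) ×ˢ Set.Ioo 0 T →
      (∫ q in Ω ×ˢ (Set.univ : Set ℝ) ×ˢ Set.Ioo 0 T,
          kineticChi u q.1 q.2.2 q.2.1 *
            (fderiv ℝ φ q (0, 0, 1) +
              ∑ j, deriv (f j) q.2.1 * fderiv ℝ φ q (Pi.single j 1, 0, 0)))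
        = (ε / 2) * ∫ q in Ω ×ˢ (Set.univ : Set ℝ) ×ˢ Set.Ioo 0 T,
            Real.sign (u q.1 q.2.2 - q.2.1) *
              (∑ j, pderiv'
                (fun y => (B (u y q.2.2) + δ) * pderiv' (fun z => u z q.2.2) j y) j q.1) *
              fderiv ℝ φ q (0, 1, 0) := by
  intro φ hφ hφs hφO
  set O : Set ((Fin d → ℝ) × ℝ) := Ω ×ˢ Ioo 0 T with hOdef
  have hO : IsOpen O := hΩopen.prod isOpen_Ioo
  set K : Set ((Fin d → ℝ) × ℝ) := (fun q : (Fin d → ℝ) × ℝ × ℝ => (q.1, q.2.2)) '' tsupport φ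
    with hKdef
  have hK : IsCompact K := hφs.isCompact.image (by fun_prop)
  have hKO : K ⊆ O := by
    rintro _ ⟨q, hq, rfl⟩
    exact ⟨(hφO hq).1, (hφO hq).2.2⟩
  have hφ1 : ContDiff ℝ 1 φ := hφ.of_le (by exact_mod_cast le_top)
  have hφd : Differentiable ℝ φ := hφ1.differentiable one_ne_zero
  have hφK : ∀ q : (Fin d → ℝ) × ℝ × ℝ, (q.1, q.2.2) ∉ K → q ∉ tsupport φ := fun q hq h =>
    hq ⟨q, h, rfl⟩
  have hφ0 : ∀ q ∉ tsupport φ, φ q = 0 := fun q hq => image_eq_zero_of_notMem_tsupport hq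
  have hfφ0 : ∀ q ∉ tsupport φ, fderiv ℝ φ q = 0 := fun q hq =>
    image_eq_zero_of_notMem_tsupport fun h => hq (tsupport_fderiv_subset ℝ h)
  have hfφc : ∀ w, Continuous fun q => fderiv ℝ φ q w := fun w =>
    (hφ1.continuous_fderiv one_ne_zero).clm_apply continuous_const
  have hf1 : ∀ j, ContDiff ℝ 1 (deriv (f j)) := fun j =>
    ((contDiff_succ_iff_deriv (n := 1)).1 (by simpa using! hf j)).2.2
  have hf1c : ∀ j, Continuous (deriv (f j)) := fun j => (hf1 j).continuous
  have hfd : ∀ j, Differentiable ℝ (f j) := fun j => (hf j).differentiable two_ne_zero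
  let U : (Fin d → ℝ) × ℝ → ℝ := fun p => u p.1 p.2
  have hU : ContinuousOn U O := hu.cont.mono (prod_mono subset_closure Ioo_subset_Icc_self)
  -- the source term
  let G : (Fin d → ℝ) × ℝ → ℝ := fun p =>
    ∑ j, pderiv' (fun y => (B (u y p.2) + δ) * pderiv' (fun z => u z p.2) j y) j p.1
  have hpde : ∀ p ∈ O, ε * G p = deriv (u p.1) p.2
      + ∑ j, deriv (f j) (U p) * pderiv' (fun y => u y p.2) j p.1 := by
    intro p hp
    rw [← hu.pde p.1 hp.1 p.2 hp.2]
    congr 1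
    refine Finset.sum_congr rfl fun j _ => ?_
    have h : HasFDerivAt (fun y => f j (u y p.2)) _ p.1 :=
      (hfd j (U p)).hasDerivAt.comp_hasFDerivAt p.1 (hu.diff_x p.1 hp.1 p.2 hp.2).hasFDerivAt
    simp [pderiv', h.fderiv]
  have hG : ContinuousOn G O := by
    have h1 : ContinuousOn (fun p => ε⁻¹ * (deriv (u p.1) p.2
        + ∑ j, deriv (f j) (U p) * pderiv' (fun y => u y p.2) j p.1)) O :=
      continuousOn_const.mul (hu.cont_dt.add (continuousOn_finsetSum _ fun j _ =>
        ((hf1c j).comp_continuousOn hU).mul (hu.cont_dx j)))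
    refine h1.congr fun p hp => ?_
    simp only [← hpde p hp]
    rw [inv_mul_cancel_left₀ hε.ne']
  -- the left-hand side
  let Ψ : (Fin d → ℝ) × ℝ × ℝ → ℝ := fun q => fderiv ℝ φ q (0, 0, 1) +
    ∑ j, deriv (f j) q.2.1 * fderiv ℝ φ q (Pi.single j 1, 0, 0)
  have hΨ0 : ∀ q ∉ tsupport φ, Ψ q = 0 := fun q hq => by simp [Ψ, hfφ0 q hq]
  have hΨi : Integrable Ψ := integrable_of_continuousOn_of_eq_zero hφs.isCompact
    (Continuous.continuousOn (by fun_prop)) hΨ0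
  have hL := integral_prod_middle (integrable_bdd_comp_mul hO hU
    (β := fun r => if r.1 < r.2 ∧ r.2 < 0 then 1 else if 0 < r.2 ∧ r.2 < r.1 then -1 else 0)
    (by
      refine Measurable.ite ?_ measurable_const
        (Measurable.ite ?_ measurable_const measurable_const)
      · exact (measurableSet_lt measurable_fst measurable_snd).inter
          (measurableSet_lt measurable_snd measurable_const)
      · exact (measurableSet_lt measurable_const measurable_snd).inter
          (measurableSet_lt measurable_snd measurable_fst))
    (fun r => by split_ifs <;> simp) hΨi
    (fun q hq => hΨ0 q (hφK q fun h => hq (hKO h))))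
  simp only [integral_kineticSign_mul] at hL
  -- the right-hand side
  let Θ : (Fin d → ℝ) × ℝ × ℝ → ℝ := fun q => G (q.1, q.2.2) * fderiv ℝ φ q (0, 1, 0)
  have hΘ0 : ∀ q ∉ tsupport φ, Θ q = 0 := fun q hq => by simp [Θ, hfφ0 q hq]
  have hΘi : Integrable Θ := by
    refine integrable_of_continuousOn_of_eq_zero hφs.isCompact
      (.mul (hG.comp (by fun_prop) fun q hq => hKO ⟨q, hq, rfl⟩) (hfφc _).continuousOn) hΘ0
  have hR := integral_prod_middle (integrable_bdd_comp_mul hO hU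
    (β := fun r => Real.sign (r.1 - r.2)) (measurable_real_sign.comp (by fun_prop))
    (fun r => by rcases Real.sign_apply_eq (r.1 - r.2) with h | h | h <;> simp [h]) hΘi
    (fun q hq => hΘ0 q (hφK q fun h => hq (hKO h))))
  have hinner : ∀ p : (Fin d → ℝ) × ℝ,
      ∫ c, Real.sign (U p - c) * Θ (p.1, c, p.2) = 2 * (G p * φ (p.1, U p, p.2)) := by
    intro p
    have hg : ContDiff ℝ 1 fun c => φ (p.1, c, p.2) := by fun_prop
    have hgs : HasCompactSupport fun c => φ (p.1, c, p.2) := by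
      refine HasCompactSupport.of_support_subset_isCompact
        (hφs.isCompact.image (f := fun q : (Fin d → ℝ) × ℝ × ℝ => q.2.1) (by fun_prop)) ?_
      exact fun c hc => ⟨(p.1, c, p.2), subset_tsupport _ hc, rfl⟩
    have hd : ∀ c, deriv (fun c => φ (p.1, c, p.2)) c = fderiv ℝ φ (p.1, c, p.2) (0, 1, 0) :=
      fun c => ((hφd (p.1, c, p.2)).hasFDerivAt.comp_hasDerivAt c ((hasDerivAt_const _ _).prodMk
        ((hasDerivAt_id c).prodMk (hasDerivAt_const _ _)))).deriv
    have := integral_sign_sub_mul_deriv (U p) hg hgs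
    simp only [hd] at this
    rw [mul_left_comm, ← this, ← integral_const_mul]
    congr 1 with c
    simp only [Θ]
    ring
  simp only [show ∀ q : (Fin d → ℝ) × ℝ × ℝ, U (q.1, q.2.2) = u q.1 q.2.2 from fun _ => rfl,
    show ∀ p : (Fin d → ℝ) × ℝ, U (p.1, p.2) = U p from fun _ => rfl] at hL hR
  simp only [hinner] at hR
  -- the exact derivatives
  have ha : ∀ h : ℝ → ℝ, ContDiff ℝ 1 h →
      ContDiff ℝ 1 fun r : ((Fin d → ℝ) × ℝ) × ℝ => h r.2 * φ (r.1.1, r.2, r.1.2) := by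
    intro h hh
    fun_prop
  have ha0 : ∀ h : ℝ → ℝ, ∀ p ∉ K, ∀ c, h c * φ (p.1, c, p.2) = 0 := fun h p hp c => by
    rw [hφ0 _ (hφK (p.1, c, p.2) hp), mul_zero]
  have hDt := integral_lineDeriv_intervalIntegral_upper (μ := volume)
    (ha (fun _ => 1) contDiff_const) hK hKO (ha0 _) hU hu.cont_dt (w := (0, 1)) (fun p hp => by
      have h : HasDerivAt (u p.1) (deriv (u p.1) p.2) (p.2 + 0) := by
        simpa using (hu.diff_t p.1 hp.1 p.2 hp.2).hasDerivAt
      simpa [HasLineDerivAt, U] using h.comp_const_add p.2 0)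
  have hDx := fun j => integral_lineDeriv_intervalIntegral_upper (μ := volume)
    (ha _ (hf1 j)) hK hKO (ha0 _) hU (hu.cont_dx j) (w := (Pi.single j 1, 0)) (fun p hp => by
      simpa [HasLineDerivAt, U, pderiv'] using
        (hu.diff_x p.1 hp.1 p.2 hp.2).hasFDerivAt.hasLineDerivAt (Pi.single j 1))
  simp only [fderiv_mul_comp_swap (h := fun _ => (1 : ℝ)) hφd (differentiable_const _)] at hDt
  simp only [one_mul] at hDt
  simp only [fderiv_mul_comp_swap hφd ((hf1 _).differentiable one_ne_zero)] at hDx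
  have hsum := integral_add hDt.1 (integrable_finsetSum Finset.univ fun j _ => (hDx j).1)
  rw [integral_finsetSum _ fun j _ => (hDx j).1, hDt.2,
    Finset.sum_eq_zero fun j _ => (hDx j).2, add_zero] at hsum
  have hpt : ∀ p : (Fin d → ℝ) × ℝ,
      (φ (p.1, U p, p.2) * deriv (u p.1) p.2
          + ∫ c in (0 : ℝ)..U p, fderiv ℝ φ (p.1, c, p.2) (0, 0, 1))
        + ∑ j, (deriv (f j) (U p) * φ (p.1, U p, p.2) * pderiv' (fun y => u y p.2) j p.1
          + ∫ c in (0 : ℝ)..U p, deriv (f j) c * fderiv ℝ φ (p.1, c, p.2) (Pi.single j 1, 0, 0))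
      = ε / 2 * (2 * (G p * φ (p.1, U p, p.2))) - -∫ c in (0 : ℝ)..U p, Ψ (p.1, c, p.2) := by
    intro p
    have hI : ∫ c in (0 : ℝ)..U p, Ψ (p.1, c, p.2)
        = (∫ c in (0 : ℝ)..U p, fderiv ℝ φ (p.1, c, p.2) (0, 0, 1))
          + ∑ j, ∫ c in (0 : ℝ)..U p,
              deriv (f j) c * fderiv ℝ φ (p.1, c, p.2) (Pi.single j 1, 0, 0) := by
      have hc : ∀ w, Continuous fun c => fderiv ℝ φ (p.1, c, p.2) w := fun w =>
        (hfφc w).comp (by fun_prop)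
      simp only [Ψ]
      rw [intervalIntegral.integral_add ((hc _).intervalIntegrable _ _)
        (Continuous.intervalIntegrable (by fun_prop) _ _),
        intervalIntegral.integral_finsetSum fun j _ =>
          Continuous.intervalIntegrable (by fun_prop) _ _]
    rw [hI, Finset.sum_add_distrib]
    by_cases hp : p ∈ O
    · have : ε / 2 * (2 * (G p * φ (p.1, U p, p.2))) = ε * G p * φ (p.1, U p, p.2) := by ring
      rw [this, hpde p hp, add_mul, Finset.sum_mul]
      have : ∀ j, deriv (f j) (U p) * φ (p.1, U p, p.2) * pderiv' (fun y => u y p.2) j p.1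
          = deriv (f j) (U p) * pderiv' (fun y => u y p.2) j p.1 * φ (p.1, U p, p.2) :=
        fun j => by ring
      simp only [this]
      ring
    · have : φ (p.1, U p, p.2) = 0 := hφ0 _ (hφK (p.1, U p, p.2) fun h => hp (hKO h))
      simp [this]
  simp only [hpt] at hsum
  rw [integral_sub (hR.1.const_mul _) hL.1, integral_const_mul, ← hL.2, ← hR.2] at hsum
  rw [setIntegral_eq_integral_of_forall_compl_eq_zero,
    setIntegral_eq_integral_of_forall_compl_eq_zero]
  · simp only [mul_assoc]
    exact (sub_eq_zero.1 hsum).symm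
  · intro q hq
    simp [hfφ0 q fun h => hq (hφO h)]
  · intro q hq
    simp [hfφ0 q fun h => hq (hφO h)]
end
end
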